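/- arXiv:2107.06608 — 4 statements merged into one kernel-verified Lean document; each statement's English description precedes it below -/
import Mathlib

section
/- Let f : ℝ^d → ℝ be twice continuously differentiable and let θ : [0,t_e) → ℝ^d be a gradient flow trajectory of f, i.e. (d/dt)θ(t) = −∇f(θ(t)). Let t̃ ∈ (0,t_e) and ε > 0, and define D_{t̃,ε} := ∪_{t∈[0,t̃]} B_ε(θ(t)), where B_ε(θ(t)) is the closed Euclidean ball of radius ε centered at θ(t). Let β_{t̃,ε}, γ_{t̃,ε} > 0 satisfy sup_{q∈D_{t̃,ε}} ‖∇²f(q)‖_spectral ≤ β_{t̃,ε} and sup_{q∈D_{t̃,ε}} ‖∇f(q)‖₂ ≤ γ_{t̃,ε}, and let m : [0,t̃] → ℝ be integrable with −λ_min(∇²f(q)) ≤ m(t) for all t ∈ [0,t̃] and all q ∈ B_ε(θ(t)). If gradient descent iterates θ_{k+1} = θ_k − η∇f(θ_k) are run with step size η > 0 satisfying η < inf_{t∈(0,t̃]} ( ε − e^{∫₀ᵗ m(t′)dt′}·‖θ_0 − θ(0)‖₂ ) / ( β_{t̃,ε}·γ_{t̃,ε}·∫₀ᵗ e^{∫_{t′}^{t}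 m(t″)dt″} dt′ ), then ‖θ_k − θ(kη)‖₂ ≤ ε for all k ∈ {1, 2, …, ⌊t̃/η⌋}. -/
open scoped RealInnerProductSpace
open MeasureTheory

noncomputable section

/-- The iterates of gradient descent with step size `η` started at `θ0`. -/
def gdIter {E : Type*} [NormedAddCommGroup E] [InnerProductSpace ℝ E] [CompleteSpace E]
    (f : E → ℝ) (η : ℝ) (θ0 : E) : ℕ → E
  | 0 => θ0
  | k + 1 => gdIter f η θ0 k - η • gradient f (gdIter f η θ0 k)

open Set Filter Topology in
/-- A continuous function that starts below a continuous barrier stays below it, provided that it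
does not cross the barrier at a contact point before which it has been below. -/
theorem le_barrier_of_eventually_le_of_eq {φ B : ℝ → ℝ} {a b : ℝ} (hab : a ≤ b)
    (hφ : ContinuousOn φ (Icc a b)) (hB : ContinuousOn B (Icc a b)) (ha : φ a ≤ B a)
    (hstep : ∀ x ∈ Ico a b, (∀ r ∈ Icc a x, φ r ≤ B r) → φ x = B x →
      ∀ᶠ y in 𝓝[>] x, φ y ≤ B y) : φ b ≤ B b := by
  have hclosed : IsClosed (Icc a b ∩ {t | φ t ≤ B t}) := by
    have h := (hφ.sub hB).preimage_isClosed_of_isClosed isClosed_Icc (isClosed_Iic (a := (0 : ℝ)))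
    convert h using 2
    ext t
    simp
  let s : Set ℝ := {t | ∀ r ∈ Icc a t, φ r ≤ B r}
  suffices h : b ∈ s from h b ⟨hab, le_rfl⟩
  refine IsClosed.mem_of_ge_of_forall_exists_gt (a := a) (s := s) ?_ ?_ hab ?_
  · refine isClosed_of_closure_subset fun t ht => ?_
    have htI : t ∈ Icc a b :=
      isClosed_Icc.closure_subset_iff.2 inter_subset_right ht
    refine ⟨fun r hr => ?_, htI⟩
    rcases hr.2.lt_or_eq with hrt | rfl
    · obtain ⟨z, hz, hzs⟩ := mem_closure_iff.1 ht (Ioi r) isOpen_Ioi hrt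
      exact hzs.1 r ⟨hr.1, le_of_lt hz⟩
    · have hsub : s ∩ Icc a b ⊆ Icc a b ∩ {t | φ t ≤ B t} :=
        fun z hz => ⟨hz.2, hz.1 z ⟨hz.2.1, le_rfl⟩⟩
      exact (hclosed.closure_subset_iff.2 hsub ht).2
  · rintro r ⟨h1, h2⟩
    rw [le_antisymm h2 h1]
    exact ha
  · rintro x ⟨hxs, hx⟩
    have hev : ∀ᶠ y in 𝓝[>] x, φ y ≤ B y := by
      rcases (hxs x ⟨hx.1, le_rfl⟩).lt_or_eq with hlt | heq
      · have hmem : Icc a b ∈ 𝓝[>] x :=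
          mem_of_superset (Ioo_mem_nhdsGT hx.2) fun y hy => ⟨hx.1.trans hy.1.le, hy.2.le⟩
        have hφx := (hφ x ⟨hx.1, hx.2.le⟩).mono_of_mem_nhdsWithin hmem
        have hBx := (hB x ⟨hx.1, hx.2.le⟩).mono_of_mem_nhdsWithin hmem
        exact (hφx.eventually_lt hBx hlt).mono fun _ h => h.le
      · exact hstep x hx hxs heq
    obtain ⟨u, hu, hsub⟩ := mem_nhdsGT_iff_exists_Ioc_subset.1 hev
    refine ⟨min u b, fun r hr => ?_, lt_min hu hx.2, min_le_right _ _⟩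
    rcases le_or_gt r x with hrx | hrx
    · exact hxs r ⟨hr.1, hrx⟩
    · exact hsub ⟨hrx, hr.2.trans (min_le_left _ _)⟩

open Set Filter Topology in
theorem HasDerivWithinAt.eventually_lt_of_eq_of_deriv_lt {φ B : ℝ → ℝ} {φ' B' x : ℝ}
    (hφ : HasDerivWithinAt φ φ' (Ioi x) x) (hB : HasDerivWithinAt B B' (Ioi x) x)
    (heq : φ x = B x) (hlt : φ' < B') : ∀ᶠ y in 𝓝[>] x, φ y < B y := by
  have h := (hasDerivWithinAt_iff_tendsto_slope' (notMem_Ioi.2 le_rfl)).1 (hB.sub hφ)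
  filter_upwards [h.eventually_const_lt (sub_pos.2 hlt), self_mem_nhdsWithin] with y hy hxy
  rw [slope_def_field] at hy
  have := (div_pos_iff_of_pos_right (sub_pos.2 hxy)).1 hy
  simp only [Pi.sub_apply] at this
  linarith

open Set Filter Topology in
theorem HasDerivWithinAt.eventually_norm_le_of_norm_eq {E : Type*} [NormedAddCommGroup E]
    [InnerProductSpace ℝ E] {e : ℝ → E} {e' : E} {B : ℝ → ℝ} {B' x : ℝ}
    (he : HasDerivWithinAt e e' (Ioi x) x) (hB : HasDerivWithinAt B B' (Ioi x) x)
    (heq : ‖e x‖ = B x) (hpos : e x ≠ 0 → ⟪e x, e'⟫ < B x * B') (hzero : e x = 0 → ‖e'‖ < B') :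
    ∀ᶠ y in 𝓝[>] x, ‖e y‖ ≤ B y := by
  by_cases h0 : e x = 0
  · have hB0 : B x = 0 := by rw [← heq, h0, norm_zero]
    obtain ⟨r, hr1, hr2⟩ := exists_between (hzero h0)
    have hr : HasDerivWithinAt (fun y => r * (y - x)) r (Ioi x) x := by
      simpa using ((hasDerivWithinAt_id x (Ioi x)).sub_const x).const_mul r
    filter_upwards [he.limsup_slope_norm_le hr1,
      hr.eventually_lt_of_eq_of_deriv_lt hB (by simp [hB0]) hr2, self_mem_nhdsWithin]
      with y hy1 hy2 hxy
    have hxy' : 0 < y - x := sub_pos.2 hxy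
    rw [h0, norm_zero, sub_zero, Real.norm_of_nonneg hxy'.le, inv_mul_lt_iff₀ hxy'] at hy1
    linarith
  · have hBpos : 0 < B x := heq ▸ norm_pos_iff.2 h0
    have hBev : ∀ᶠ y in 𝓝[>] x, 0 < B y := hB.continuousWithinAt.eventually_const_lt hBpos
    have hsq := he.norm_sq.eventually_lt_of_eq_of_deriv_lt (hB.pow 2)
      (by simp [heq]) (by have := hpos h0; simp; linarith)
    filter_upwards [hBev, hsq] with y hy1 hy2
    exact le_of_lt (lt_of_pow_lt_pow_left₀ 2 hy1.le hy2)

/-- One-sided monotonicity of a vector field from a lower bound on its derivative on a ball. -/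
theorem neg_mul_norm_sq_le_inner_sub_of_fderiv {E : Type*} [NormedAddCommGroup E]
    [InnerProductSpace ℝ E] {g : E → E} (hg : Differentiable ℝ g) {p u : E} {ε μ : ℝ}
    (hμ : ∀ q ∈ Metric.closedBall p ε, ∀ v, -μ * ‖v‖ ^ 2 ≤ ⟪v, fderiv ℝ g q v⟫)
    (hu : u ∈ Metric.closedBall p ε) : -μ * ‖u - p‖ ^ 2 ≤ ⟪u - p, g u - g p⟫ := by
  have hline : ∀ s : ℝ, HasDerivAt (fun s : ℝ => p + s • (u - p)) (u - p) s := fun s => by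
    simpa using ((hasDerivAt_id s).smul_const (u - p)).const_add p
  have hd : ∀ s : ℝ, HasDerivAt (fun s : ℝ => ⟪u - p, g (p + s • (u - p))⟫)
      ⟪u - p, fderiv ℝ g (p + s • (u - p)) (u - p)⟫ s := fun s => by
    simpa using (hasDerivAt_const s (u - p)).inner ℝ
      ((hg (p + s • (u - p))).hasFDerivAt.comp_hasDerivAt s (hline s))
  obtain ⟨s, hs, hslope⟩ := exists_hasDerivAt_eq_slope _ _ zero_lt_one
    (fun s _ => (hd s).continuousAt.continuousWithinAt) (fun s _ => hd s)
  have hmem : p + s • (u - p) ∈ Metric.closedBall p ε := by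
    rw [mem_closedBall_iff_norm] at hu ⊢
    rw [add_sub_cancel_left, norm_smul, Real.norm_of_nonneg hs.1.le]
    nlinarith [norm_nonneg (u - p), hs.1, hs.2]
  have h := hμ _ hmem (u - p)
  rw [hslope] at h
  simpa [inner_sub_right] using h

open Set Filter Topology in
/-- If the barrier `B` solves `B' = μ B + c` and stays below `ε`, then one explicit Euler step for
the flow of `-g` does not cross it. -/
theorem norm_euler_step_sub_flow_le {E : Type*} [NormedAddCommGroup E] [InnerProductSpace ℝ E]
    {g : E → E} (hg : Differentiable ℝ g) {θ : ℝ → E} {a b ε β γ c : ℝ} (hab : a ≤ b)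
    (hθ : ∀ t ∈ Ico a b, HasDerivWithinAt θ (-g (θ t)) (Ioi t) t)
    (hθc : ContinuousOn θ (Icc a b)) (hβ0 : 0 ≤ β)
    (hβ : ∀ t ∈ Icc a b, ∀ q ∈ Metric.closedBall (θ t) ε, ‖fderiv ℝ g q‖ ≤ β)
    (hγ : ∀ t ∈ Icc a b, ∀ q ∈ Metric.closedBall (θ t) ε, ‖g q‖ ≤ γ) {μ B : ℝ → ℝ}
    (hμ : ∀ t ∈ Icc a b, ∀ q ∈ Metric.closedBall (θ t) ε, ∀ v,
      -(μ t) * ‖v‖ ^ 2 ≤ ⟪v, fderiv ℝ g q v⟫)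
    (hB : ∀ t, HasDerivAt B (μ t * B t + c) t) (hBε : ∀ t ∈ Icc a b, B t ≤ ε)
    (hc : β * γ * (b - a) < c) {p : E} (hp : ‖p - θ a‖ ≤ B a) :
    ‖p - (b - a) • g p - θ b‖ ≤ B b := by
  have hpball : p ∈ Metric.closedBall (θ a) ε :=
    mem_closedBall_iff_norm.2 (hp.trans (hBε a ⟨le_rfl, hab⟩))
  have hgp : ‖g p‖ ≤ γ := hγ a ⟨le_rfl, hab⟩ p hpball
  let u : ℝ → E := fun t => p - (t - a) • g p
  have hu : ∀ t, HasDerivAt u (-g p) t := fun t => by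
    simpa using (((hasDerivAt_id t).sub_const a).smul_const (g p)).const_sub p
  have huc : Continuous u := continuous_iff_continuousAt.2 fun t => (hu t).continuousAt
  refine le_barrier_of_eventually_le_of_eq (φ := fun t => ‖u t - θ t‖) hab
    (huc.continuousOn.sub hθc).norm (fun t _ => (hB t).continuousAt.continuousWithinAt)
    (by simpa [u] using hp) fun x hx hle heq => ?_
  have hxI : x ∈ Icc a b := ⟨hx.1, hx.2.le⟩
  have hball : ∀ r ∈ Icc a x, u r ∈ Metric.closedBall (θ r) ε := fun r hr =>
    mem_closedBall_iff_norm.2 ((hle r hr).trans (hBε r ⟨hr.1, hr.2.trans hx.2.le⟩))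
  have hlip : ‖g (u x) - g p‖ < c := by
    have h1 : ‖g (u x) - g p‖ ≤ β * ‖u x - p‖ := by
      refine (convex_segment p (u x)).norm_image_sub_le_of_norm_fderiv_le (𝕜 := ℝ)
        (fun q _ => hg q) (fun q hq => ?_) (left_mem_segment ℝ _ _) (right_mem_segment ℝ _ _)
      rw [segment_eq_image'] at hq
      obtain ⟨s, hs, rfl⟩ := hq
      have hr : a + s * (x - a) ∈ Icc a x := by
        constructor <;> nlinarith [hs.1, hs.2, hx.1]
      have hq : p + s • (u x - p) = u (a + s * (x - a)) := by
        simp only [u]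
        module
      simp only [hq]
      exact hβ _ ⟨hr.1, hr.2.trans hx.2.le⟩ _ (hball _ hr)
    have h2 : ‖u x - p‖ ≤ γ * (b - a) := by
      have : u x - p = -((x - a) • g p) := by simp [u]
      rw [this, norm_neg, norm_smul, Real.norm_of_nonneg (sub_nonneg.2 hx.1)]
      nlinarith [norm_nonneg (g p), hx.1, hx.2]
    nlinarith
  have hmono := neg_mul_norm_sq_le_inner_sub_of_fderiv hg (hμ x hxI) (hball x ⟨hx.1, le_rfl⟩)
  have hderiv : HasDerivWithinAt (fun t => u t - θ t) (-g p - -g (θ x)) (Ioi x) x :=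
    (hu x).hasDerivWithinAt.sub (hθ x hx)
  refine hderiv.eventually_norm_le_of_norm_eq (hB x).hasDerivWithinAt heq (fun hne => ?_)
    fun h0 => ?_
  · have hpos : 0 < ‖u x - θ x‖ := norm_pos_iff.2 hne
    have hsplit : -g p - -g (θ x) = (g (u x) - g p) - (g (u x) - g (θ x)) := by abel
    have hcs := real_inner_le_norm (u x - θ x) (g (u x) - g p)
    have heq' : ‖u x - θ x‖ = B x := heq
    rw [hsplit, inner_sub_right]
    rw [heq'] at hmono hcs hpos
    nlinarith [mul_lt_mul_of_pos_left hlip hpos]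
  · have hB0 : B x = 0 := by rw [← heq, h0, norm_zero]
    rw [← sub_eq_zero.1 h0, neg_sub_neg, hB0, mul_zero, zero_add]
    exact hlip

open Set in
/-- A continuous vector-valued curve whose surrounding balls of radius `ε` satisfy a quadratic-form
lower bound `-m` admits a continuous such bound `-μ` with `μ ≤ m`. -/
theorem exists_continuous_le_of_neg_mul_norm_sq_le_inner {E : Type*} [NormedAddCommGroup E]
    [InnerProductSpace ℝ E] [FiniteDimensional ℝ E] [Nontrivial E] {H : E → E →L[ℝ] E}
    (hH : Continuous H) {θ : ℝ → E} {a b ε : ℝ} (hab : a ≤ b) (hε : 0 ≤ ε)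
    (hθ : ContinuousOn θ (Icc a b)) {m : ℝ → ℝ}
    (hm : ∀ t ∈ Icc a b, ∀ q ∈ Metric.closedBall (θ t) ε, ∀ v,
      -(m t) * ‖v‖ ^ 2 ≤ ⟪v, H q v⟫) :
    ∃ μ : ℝ → ℝ, Continuous μ ∧ (∀ t ∈ Icc a b, μ t ≤ m t) ∧
      ∀ t ∈ Icc a b, ∀ q ∈ Metric.closedBall (θ t) ε, ∀ v,
        -(μ t) * ‖v‖ ^ 2 ≤ ⟪v, H q v⟫ := by
  have : ProperSpace E := FiniteDimensional.proper_real E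
  let K : Set (E × E) := Metric.closedBall 0 ε ×ˢ Metric.sphere 0 1
  have hK : IsCompact K := (isCompact_closedBall _ _).prod (isCompact_sphere _ _)
  have hKne : K.Nonempty :=
    (Metric.nonempty_closedBall.2 hε).prod (NormedSpace.sphere_nonempty.2 zero_le_one)
  let θ' : ℝ → E := IccExtend hab ((Icc a b).domRestrict θ)
  have hθ' : Continuous θ' := (continuousOn_iff_continuous_domRestrict.1 hθ).Icc_extend'
  have hθ'eq : ∀ t ∈ Icc a b, θ' t = θ t := fun t ht => IccExtend_of_mem _ _ ht
  let F : ℝ → E × E → ℝ := fun t w => -⟪w.2, H (θ' t + w.1) w.2⟫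
  have hF : Continuous ↿F := by
    change Continuous fun z : ℝ × E × E => -⟪z.2.2, H (θ' z.1 + z.2.1) z.2.2⟫
    fun_prop
  refine ⟨fun t => sSup (F t '' K), hK.continuous_sSup hF, fun t ht => ?_,
    fun t ht q hq v => ?_⟩
  · refine csSup_le (hKne.image _) ?_
    rintro _ ⟨⟨w, v⟩, ⟨hw, hv⟩, rfl⟩
    have h := hm t ht (θ t + w) (by simpa using hw) v
    rw [mem_sphere_zero_iff_norm.1 hv] at h
    simp only [F, hθ'eq t ht]
    linarith
  · rcases eq_or_ne v 0 with rfl | hv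
    · simp
    have hv' : 0 < ‖v‖ := norm_pos_iff.2 hv
    have hbdd : BddAbove (F t '' K) :=
      (hK.image (hF.comp (Continuous.prodMk_right t))).bddAbove
    have hmem : (q - θ t, ‖v‖⁻¹ • v) ∈ K := by
      refine ⟨?_, ?_⟩
      · exact mem_closedBall_zero_iff.2 (mem_closedBall_iff_norm.1 hq)
      · simp [norm_smul, hv'.ne']
    have h := le_csSup hbdd (mem_image_of_mem (F t) hmem)
    have hF' : F t (q - θ t, ‖v‖⁻¹ • v) = -(‖v‖⁻¹ * (‖v‖⁻¹ * ⟪v, H q v⟫)) := by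
      simp only [F, hθ'eq t ht, add_sub_cancel, map_smul, inner_smul_left, inner_smul_right,
        conj_trivial]
    rw [hF'] at h
    have hscale : ‖v‖ ^ 2 * (‖v‖⁻¹ * (‖v‖⁻¹ * ⟪v, H q v⟫)) = ⟪v, H q v⟫ := by
      field_simp
    have hmul := mul_le_mul_of_nonneg_left h (sq_nonneg ‖v‖)
    linarith

open Set in
theorem intervalIntegrable_exp_integral {m : ℝ → ℝ} {t : ℝ} (ht : 0 ≤ t)
    (hm : IntegrableOn m (Icc 0 t)) :
    IntervalIntegrable (fun s : ℝ => Real.exp (∫ r in s..t, m r)) volume 0 t := by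
  refine (Real.continuous_exp.comp_continuousOn ?_).intervalIntegrable
  simp_rw [intervalIntegral.integral_symm t]
  rw [← uIcc_of_ge ht] at hm
  rw [uIcc_comm]
  exact (intervalIntegral.continuousOn_primitive_interval hm).neg

/-- The solution of `B' = μ B + c` with `B 0 = a`. -/
theorem hasDerivAt_linear_ode_solution {μ : ℝ → ℝ} (hμ : Continuous μ) (a c t : ℝ) :
    HasDerivAt (fun t : ℝ => Real.exp (∫ s in (0 : ℝ)..t, μ s) *
        (a + c * ∫ s in (0 : ℝ)..t, Real.exp (-∫ r in (0 : ℝ)..s, μ r)))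
      (μ t * (Real.exp (∫ s in (0 : ℝ)..t, μ s) *
        (a + c * ∫ s in (0 : ℝ)..t, Real.exp (-∫ r in (0 : ℝ)..s, μ r))) + c) t := by
  have hM : ∀ t, HasDerivAt (fun t : ℝ => ∫ s in (0 : ℝ)..t, μ s) (μ t) t := fun t =>
    (hμ.integral_hasStrictDerivAt 0 t).hasDerivAt
  have hMc : Continuous fun t : ℝ => ∫ s in (0 : ℝ)..t, μ s :=
    continuous_iff_continuousAt.2 fun t => (hM t).continuousAt
  have hJ := ((Real.continuous_exp.comp hMc.neg).integral_hasStrictDerivAt 0 t).hasDerivAt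
  refine ((hM t).exp.mul ((hJ.const_mul c).const_add a)).congr_deriv ?_
  have hcancel : Real.exp (∫ s in (0 : ℝ)..t, μ s) * Real.exp (-∫ s in (0 : ℝ)..t, μ s) = 1 := by
    rw [← Real.exp_add, add_neg_cancel, Real.exp_zero]
  simp only [Function.comp_apply]
  linear_combination c * hcancel

open Set in
theorem linear_ode_solution_le {μ m : ℝ → ℝ} (hμ : Continuous μ) {t a c : ℝ} (ht : 0 ≤ t)
    (hm : IntegrableOn m (Icc 0 t)) (hle : ∀ s ∈ Icc 0 t, μ s ≤ m s) (ha : 0 ≤ a) (hc : 0 ≤ c) :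
    Real.exp (∫ s in (0 : ℝ)..t, μ s) *
        (a + c * ∫ s in (0 : ℝ)..t, Real.exp (-∫ r in (0 : ℝ)..s, μ r)) ≤
      Real.exp (∫ s in (0 : ℝ)..t, m s) * a +
        c * ∫ s in (0 : ℝ)..t, Real.exp (∫ r in s..t, m r) := by
  have hmint : ∀ s ∈ Icc 0 t, IntervalIntegrable m volume s t := fun s hs =>
    (intervalIntegrable_iff_integrableOn_Icc_of_le hs.2).2 (hm.mono_set (Icc_subset_Icc_left hs.1))
  have hintle : ∀ s ∈ Icc 0 t, ∫ r in s..t, μ r ≤ ∫ r in s..t, m r := fun s hs =>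
    intervalIntegral.integral_mono_on hs.2 (hμ.intervalIntegrable _ _) (hmint s hs)
      fun r hr => hle r ⟨hs.1.trans hr.1, hr.2⟩
  have hμc : Continuous fun s : ℝ => ∫ r in s..t, μ r := by
    simp_rw [intervalIntegral.integral_symm t]
    exact (intervalIntegral.continuous_primitive (fun _ _ => hμ.intervalIntegrable _ _) t).neg
  have hJ : Real.exp (∫ s in (0 : ℝ)..t, μ s) *
      (∫ s in (0 : ℝ)..t, Real.exp (-∫ r in (0 : ℝ)..s, μ r)) =
        ∫ s in (0 : ℝ)..t, Real.exp (∫ r in s..t, μ r) := by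
    rw [← intervalIntegral.integral_const_mul]
    refine intervalIntegral.integral_congr fun s _ => ?_
    rw [← Real.exp_add, ← sub_eq_add_neg, intervalIntegral.integral_interval_sub_left
      (hμ.intervalIntegrable _ _) (hμ.intervalIntegrable _ _)]
  have hJle : ∫ s in (0 : ℝ)..t, Real.exp (∫ r in s..t, μ r) ≤
      ∫ s in (0 : ℝ)..t, Real.exp (∫ r in s..t, m r) :=
    intervalIntegral.integral_mono_on ht (Real.continuous_exp.comp hμc |>.intervalIntegrable _ _)
      (intervalIntegrable_exp_integral ht hm)
      fun s hs => Real.exp_le_exp.2 (hintle s hs)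
  rw [mul_add, mul_left_comm, hJ]
  gcongr
  exact hintle 0 ⟨le_rfl, ht⟩

theorem ContDiff.gradient_one {E : Type*} [NormedAddCommGroup E] [InnerProductSpace ℝ E]
    [CompleteSpace E] {f : E → ℝ} (hf : ContDiff ℝ 2 f) : ContDiff ℝ 1 (gradient f) :=
  (InnerProductSpace.toDual ℝ E).symm.contDiff.comp (hf.fderiv_right (by norm_num))

/-- Theorem 3 of the paper: if the step size `η` of gradient descent is
smaller than an explicit quantity determined by a smoothness constant `β`, a Lipschitz
constant `γ` and a bound `m` on minus the minimal eigenvalue of the Hessian in an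
`ε`-neighborhood of the gradient flow trajectory, then the first `⌊t̃/η⌋` iterates of
gradient descent `ε`-approximate the gradient flow trajectory up to time `t̃`. -/
theorem gradient_descent_matches_gradient_flow {d : ℕ}
    (f : EuclideanSpace ℝ (Fin d) → ℝ) (hf : ContDiff ℝ 2 f)
    (te : ℝ) (θ : ℝ → EuclideanSpace ℝ (Fin d))
    (hθ : ∀ t ∈ Set.Ico (0 : ℝ) te,
      HasDerivWithinAt θ (-gradient f (θ t)) (Set.Ico (0 : ℝ) te) t)
    (tf : ℝ) (htf0 : 0 < tf) (htfe : tf < te)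
    (ε : ℝ) (hε : 0 < ε)
    (β γ : ℝ) (hβ0 : 0 < β) (hγ0 : 0 < γ)
    (hβ : ∀ t ∈ Set.Icc (0 : ℝ) tf, ∀ q ∈ Metric.closedBall (θ t) ε,
      ‖fderiv ℝ (gradient f) q‖ ≤ β)
    (hγ : ∀ t ∈ Set.Icc (0 : ℝ) tf, ∀ q ∈ Metric.closedBall (θ t) ε,
      ‖gradient f q‖ ≤ γ)
    (m : ℝ → ℝ) (hm : IntegrableOn m (Set.Icc (0 : ℝ) tf))
    (hmbound : ∀ t ∈ Set.Icc (0 : ℝ) tf, ∀ q ∈ Metric.closedBall (θ t) ε,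
      ∀ v : EuclideanSpace ℝ (Fin d),
        -(m t) * ‖v‖ ^ 2 ≤ ⟪v, fderiv ℝ (gradient f) q v⟫)
    (θ0 : EuclideanSpace ℝ (Fin d)) (η : ℝ) (hη0 : 0 < η)
    (hη : η < sInf {r : ℝ | ∃ t ∈ Set.Ioc (0 : ℝ) tf,
      r = (ε - Real.exp (∫ t' in (0 : ℝ)..t, m t') * ‖θ0 - θ 0‖) /
        (β * γ * ∫ t' in (0 : ℝ)..t, Real.exp (∫ t'' in t'..t, m t''))}) :
    ∀ k : ℕ, 1 ≤ k → k ≤ ⌊tf / η⌋₊ → ‖gdIter f η θ0 k - θ (k * η)‖ ≤ ε := by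
  intro k _ hk
  rcases subsingleton_or_nontrivial (EuclideanSpace ℝ (Fin d)) with hsub | hnon
  · rw [Subsingleton.elim (gdIter f η θ0 k - θ (k * η)) 0, norm_zero]
    exact hε.le
  have hg : ContDiff ℝ 1 (gradient f) := hf.gradient_one
  have hsubset : Set.Icc 0 tf ⊆ Set.Ico 0 te := Set.Icc_subset_Ico_right htfe
  have hθc : ContinuousOn θ (Set.Icc 0 tf) := fun t ht =>
    (hθ t (hsubset ht)).continuousWithinAt.mono hsubset
  have hθr : ∀ t ∈ Set.Ico 0 tf, HasDerivWithinAt θ (-gradient f (θ t)) (Set.Ioi t) t :=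
    fun t ht => (hθ t ⟨ht.1, ht.2.trans htfe⟩).mono_of_mem_nhdsWithin
      (Filter.mem_of_superset (Ioo_mem_nhdsGT (ht.2.trans htfe))
        fun y hy => ⟨ht.1.trans hy.1.le, hy.2⟩)
  obtain ⟨μ, hμc, hμle, hμ⟩ := exists_continuous_le_of_neg_mul_norm_sq_le_inner
    (hg.continuous_fderiv one_ne_zero) htf0.le hε.le hθc hmbound
  set S : Set ℝ := {r : ℝ | ∃ t ∈ Set.Ioc (0 : ℝ) tf,
      r = (ε - Real.exp (∫ t' in (0 : ℝ)..t, m t') * ‖θ0 - θ 0‖) /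
        (β * γ * ∫ t' in (0 : ℝ)..t, Real.exp (∫ t'' in t'..t, m t''))}
  set c : ℝ := β * γ * sInf S with hcdef
  have hβγ : 0 < β * γ := mul_pos hβ0 hγ0
  have hInf0 : 0 < sInf S := hη0.trans hη
  have hbdd : BddBelow S := by
    by_contra h
    exact hInf0.ne' (Real.sInf_of_not_bddBelow h)
  have hc0 : 0 < c := mul_pos hβγ hInf0
  let B : ℝ → ℝ := fun t => Real.exp (∫ s in (0 : ℝ)..t, μ s) *
    (‖θ0 - θ 0‖ + c * ∫ s in (0 : ℝ)..t, Real.exp (-∫ r in (0 : ℝ)..s, μ r))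
  have hB : ∀ t, HasDerivAt B (μ t * B t + c) t := hasDerivAt_linear_ode_solution hμc _ c
  have hBc : Continuous B := continuous_iff_continuousAt.2 fun t => (hB t).continuousAt
  have hBIoc : ∀ t ∈ Set.Ioc 0 tf, B t ≤ ε := fun t ht => by
    have hmt : IntegrableOn m (Set.Icc 0 t) := hm.mono_set (Set.Icc_subset_Icc_right ht.2)
    have hJ : 0 < ∫ t' in (0 : ℝ)..t, Real.exp (∫ t'' in t'..t, m t'') :=
      intervalIntegral.intervalIntegral_pos_of_pos_on
        (intervalIntegrable_exp_integral ht.1.le hmt) (fun _ _ => Real.exp_pos _) ht.1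
    have hr := csInf_le hbdd (show _ ∈ S from ⟨t, ht, rfl⟩)
    rw [le_div_iff₀ (mul_pos hβγ hJ)] at hr
    refine (linear_ode_solution_le hμc ht.1.le hmt
      (fun s hs => hμle s ⟨hs.1, hs.2.trans ht.2⟩) (norm_nonneg _) hc0.le).trans ?_
    rw [hcdef]
    linarith
  have hBε : ∀ t ∈ Set.Icc 0 tf, B t ≤ ε := by
    rw [← closure_Ioc htf0.ne]
    exact (isClosed_le hBc continuous_const).closure_subset_iff.2 hBIoc
  have key : ∀ n : ℕ, n * η ≤ tf → ‖gdIter f η θ0 n - θ (n * η)‖ ≤ B (n * η) := by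
    intro n
    induction n with
    | zero => simp [gdIter, B]
    | succ n ih =>
      intro hn
      have hlen : ((n + 1 : ℕ) : ℝ) * η - n * η = η := by push_cast; ring
      have hab : (n : ℝ) * η ≤ ((n + 1 : ℕ) : ℝ) * η := by linarith
      have hsub : Set.Icc ((n : ℝ) * η) (((n + 1 : ℕ) : ℝ) * η) ⊆ Set.Icc 0 tf :=
        Set.Icc_subset_Icc (by positivity) hn
      have h := norm_euler_step_sub_flow_le (hg.differentiable one_ne_zero) hab
        (fun t ht => hθr t ⟨(hsub ⟨ht.1, ht.2.le⟩).1, ht.2.trans_le hn⟩) (hθc.mono hsub) hβ0.le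
        (fun t ht => hβ t (hsub ht)) (fun t ht => hγ t (hsub ht)) (fun t ht => hμ t (hsub ht)) hB
        (fun t ht => hBε t (hsub ht)) (by rw [hlen]; exact mul_lt_mul_of_pos_left hη hβγ)
        (ih (hab.trans hn))
      rwa [hlen] at h
  have hkη : k * η ≤ tf := by
    rw [← le_div_iff₀ hη0]
    exact (Nat.cast_le.2 hk).trans (Nat.floor_le (div_nonneg htf0.le hη0.le))
  exact (key k hkη).trans (hBε _ ⟨by positivity, hkη⟩)
end
end

section
/- Let f : ℝ^d → ℝ be twice continuously differentiable, non-negative, and β-smooth with β > 0 (i.e. ‖∇²f(q)‖_spectral ≤ β for all q ∈ ℝ^d). Set m := −inf_{q∈ℝ^d} λ_min(∇²f(q)). Let θ : [0,t_e) → ℝ^d be a gradient flow trajectory of f, let t̃ ∈ (0,t_e), ε > 0, and put c := ( √(2β³·f(θ(0))) + β²ε )^{−1}. If gradient descent iterates θ_{k+1} = θ_k − η∇f(θ_k) are run with step size η > 0 satisfying: η < c·(ε − ‖θ_0 − θ(0)‖₂)·|m| when m < 0; η < c·(ε − ‖θ_0 − θ(0)‖₂)·(1/t̃) when m = 0; and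 η < c·(ε − ‖θ_0 − θ(0)‖₂·e^{m t̃})·(e^{m t̃} − 1)^{−1}·m when m > 0 — then ‖θ_k − θ(kη)‖₂ ≤ ε for all k ∈ {1, 2, …, ⌊t̃/η⌋}. -/
open scoped RealInnerProductSpace
open MeasureTheory

noncomputable section

section GradientFlow

open Set Filter Topology

variable {E : Type*} [NormedAddCommGroup E] [InnerProductSpace ℝ E]

/-- A one-sided Grönwall inequality: only the component of the derivative along the
function itself has to be controlled, and the rate `K` may be negative. -/
theorem norm_le_gronwallBound_of_inner_deriv_right_le {e e' : ℝ → E} {δ K ε a b : ℝ}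
    (he : ContinuousOn e (Icc a b)) (he' : ∀ x ∈ Ico a b, HasDerivWithinAt e (e' x) (Ici x) x)
    (ha : ‖e a‖ ≤ δ) (hzero : ∀ x ∈ Ico a b, e x = 0 → ‖e' x‖ ≤ ε)
    (hinner : ∀ x ∈ Ico a b, ⟪e x, e' x⟫ ≤ K * ‖e x‖ ^ 2 + ε * ‖e x‖) :
    ∀ x ∈ Icc a b, ‖e x‖ ≤ gronwallBound δ K ε (x - a) := by
  refine le_gronwallBound_of_liminf_deriv_right_le
    (f' := fun x => K * ‖e x‖ + ε) he.norm ?_ ha fun _ _ => le_rfl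
  intro x hx r hr
  by_cases h0 : e x = 0
  · refine (he' x hx).liminf_right_slope_norm_le (lt_of_le_of_lt ?_ hr)
    simpa [h0] using hzero x hx h0
  · have hpos : 0 < ‖e x‖ := norm_pos_iff.mpr h0
    have hd : HasDerivWithinAt (fun t => ‖e t‖) (⟪e x, e' x⟫ / ‖e x‖) (Ici x) x := by
      have h := (he' x hx).norm_sq.sqrt (pow_ne_zero 2 hpos.ne')
      simp only [Real.sqrt_sq (norm_nonneg _)] at h
      convert! h using 1
      field_simp
    have hlt : ⟪e x, e' x⟫ / ‖e x‖ < r := by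
      refine lt_of_le_of_lt ?_ hr
      rw [div_le_iff₀ hpos]
      linarith [hinner x hx]
    exact hd.liminf_right_slope_le hlt

theorem gronwallBound_gronwallBound (δ K ε s t : ℝ) :
    gronwallBound (gronwallBound δ K ε s) K ε t = gronwallBound δ K ε (s + t) := by
  by_cases hK : K = 0
  · subst hK
    simp only [gronwallBound_K0]
    ring
  · simp only [gronwallBound_of_K_ne_0 hK, mul_add, Real.exp_add]
    ring

variable [CompleteSpace E] {f : E → ℝ} {β : ℝ}

theorem ContDiff.gradient_of_two (hf : ContDiff ℝ 2 f) : ContDiff ℝ 1 (gradient f) :=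
  (InnerProductSpace.toDual ℝ E).symm.contDiff.comp (hf.fderiv_right (m := 1) (by norm_num))

theorem norm_gradient_sub_le (hf : ContDiff ℝ 2 f)
    (hsmooth : ∀ q, ‖fderiv ℝ (gradient f) q‖ ≤ β) (x y : E) :
    ‖gradient f x - gradient f y‖ ≤ β * ‖x - y‖ :=
  convex_univ.norm_image_sub_le_of_norm_fderiv_le
    (fun z _ => hf.gradient_of_two.differentiable one_ne_zero z)
    (fun z _ => hsmooth z) (mem_univ y) (mem_univ x)

/-- A uniform lower bound on the Hessian quadratic form makes the gradient one-sided
Lipschitz. -/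
theorem inner_gradient_sub_ge (hf : ContDiff ℝ 2 f) {m : ℝ}
    (hm : ∀ q v, -m * ‖v‖ ^ 2 ≤ ⟪v, fderiv ℝ (gradient f) q v⟫) (x y : E) :
    -m * ‖x - y‖ ^ 2 ≤ ⟪x - y, gradient f x - gradient f y⟫ := by
  have hd : ∀ s : ℝ, HasDerivAt (fun s : ℝ => ⟪x - y, gradient f (y + s • (x - y))⟫)
      ⟪x - y, fderiv ℝ (gradient f) (y + s • (x - y)) (x - y)⟫ s := by
    intro s
    have h1 : HasDerivAt (fun s : ℝ => y + s • (x - y)) (x - y) s := by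
      simpa using ((hasDerivAt_id s).smul_const (x - y)).const_add y
    have h2 := ((hf.gradient_of_two.differentiable one_ne_zero
      (y + s • (x - y))).hasFDerivAt).comp_hasDerivAt s h1
    simpa using (hasDerivAt_const s (x - y)).inner ℝ h2
  obtain ⟨s, -, hs⟩ := exists_hasDerivAt_eq_slope _ _ (zero_lt_one' ℝ)
    (fun s _ => (hd s).continuousAt.continuousWithinAt) (fun s _ => hd s)
  have h := hm (y + s • (x - y)) (x - y)
  rw [hs] at h
  simpa [inner_sub_right] using h

theorem HasDerivWithinAt.comp_gradient (hf : Differentiable ℝ f) {θ : ℝ → E} {v : E}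
    {s : Set ℝ} {t : ℝ} (hθ : HasDerivWithinAt θ v s t) :
    HasDerivWithinAt (fun r => f (θ r)) ⟪gradient f (θ t), v⟫ s t := by
  have h := (hf (θ t)).hasGradientAt.hasFDerivAt.comp_hasDerivWithinAt t hθ
  rwa [InnerProductSpace.toDual_apply_apply] at h

theorem norm_gradient_sq_le (hf : ContDiff ℝ 2 f) (hnonneg : ∀ q, 0 ≤ f q) (hβ : 0 < β)
    (hsmooth : ∀ q, ‖fderiv ℝ (gradient f) q‖ ≤ β) (x : E) :
    ‖gradient f x‖ ^ 2 ≤ 2 * β * f x := by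
  set g := gradient f x
  have hd : ∀ s : ℝ, HasDerivAt
      (fun s : ℝ => f (x - s • g) + (s * ‖g‖ ^ 2 - β * ‖g‖ ^ 2 * s ^ 2 / 2))
      (⟪gradient f (x - s • g), -g⟫ + (‖g‖ ^ 2 - β * ‖g‖ ^ 2 * s)) s := by
    intro s
    have h1 : HasDerivAt (fun s : ℝ => x - s • g) (-g) s := by
      simpa using ((hasDerivAt_id s).smul_const g).const_sub x
    have h2 := (h1.hasDerivWithinAt (s := univ)).comp_gradient
      (hf.differentiable two_ne_zero) |>.hasDerivAt univ_mem
    have h3 : HasDerivAt (fun s : ℝ => s * ‖g‖ ^ 2 - β * ‖g‖ ^ 2 * s ^ 2 / 2)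
        (‖g‖ ^ 2 - β * ‖g‖ ^ 2 * s) s := by
      convert! ((hasDerivAt_id s).mul_const (‖g‖ ^ 2)).sub
        ((((hasDerivAt_id s).pow 2).const_mul (β * ‖g‖ ^ 2)).div_const 2) using 1
      simp
      ring
    exact h2.add h3
  have hanti : AntitoneOn
      (fun s : ℝ => f (x - s • g) + (s * ‖g‖ ^ 2 - β * ‖g‖ ^ 2 * s ^ 2 / 2)) (Ici 0) := by
    refine antitoneOn_of_hasDerivWithinAt_nonpos (convex_Ici 0)
      (fun s _ => (hd s).continuousAt.continuousWithinAt)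
      (fun s _ => (hd s).hasDerivWithinAt) ?_
    intro s hs
    have hs0 : 0 ≤ s := interior_subset hs
    have h1 : ⟪g - gradient f (x - s • g), g⟫ ≤ β * ‖g‖ ^ 2 * s := by
      calc ⟪g - gradient f (x - s • g), g⟫
          ≤ ‖g - gradient f (x - s • g)‖ * ‖g‖ := real_inner_le_norm _ _
        _ ≤ (β * ‖x - (x - s • g)‖) * ‖g‖ := by
            gcongr
            exact norm_gradient_sub_le hf hsmooth _ _
        _ = β * ‖g‖ ^ 2 * s := by
            rw [sub_sub_cancel, norm_smul, Real.norm_of_nonneg hs0]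
            ring
    rw [inner_sub_left, real_inner_self_eq_norm_sq] at h1
    rw [inner_neg_right]
    linarith
  have hβ0 : (0 : ℝ) ≤ 1 / β := by positivity
  have h := hanti self_mem_Ici hβ0 hβ0
  have hn := hnonneg (x - (1 / β) • g)
  have hkey : 1 / β * ‖g‖ ^ 2 - β * ‖g‖ ^ 2 * (1 / β) ^ 2 / 2 = ‖g‖ ^ 2 / (2 * β) := by
    field_simp
    ring
  simp only [hkey, zero_smul, sub_zero] at h
  have h2 : ‖g‖ ^ 2 / (2 * β) ≤ f x := by linarith
  rw [div_le_iff₀ (by positivity)] at h2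
  linarith

theorem antitoneOn_comp_gradientFlow (hf : Differentiable ℝ f) {te : ℝ} {θ : ℝ → E}
    (hθ : ∀ t ∈ Ico (0 : ℝ) te,
      HasDerivWithinAt θ (-gradient f (θ t)) (Ico (0 : ℝ) te) t) :
    AntitoneOn (fun t => f (θ t)) (Ico 0 te) := by
  have hd := fun t ht => (hθ t ht).comp_gradient hf
  refine antitoneOn_of_hasDerivWithinAt_nonpos (convex_Ico 0 te)
    (fun t ht => (hd t ht).continuousWithinAt)
    (fun t ht => (hd t (interior_subset ht)).mono interior_subset) ?_
  intro t _
  rw [inner_neg_right, real_inner_self_eq_norm_sq]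
  exact neg_nonpos.mpr (sq_nonneg _)

/-- Growth of the distance between a gradient flow trajectory and a gradient descent
iterate over a single step. -/
theorem norm_gradientDescent_step_sub_gradientFlow_le (hf : ContDiff ℝ 2 f) (hβ : 0 < β)
    (hsmooth : ∀ q, ‖fderiv ℝ (gradient f) q‖ ≤ β) {m : ℝ}
    (hm : ∀ q v, -m * ‖v‖ ^ 2 ≤ ⟪v, fderiv ℝ (gradient f) q v⟫) {te : ℝ} {θ : ℝ → E}
    (hθ : ∀ t ∈ Ico (0 : ℝ) te,
      HasDerivWithinAt θ (-gradient f (θ t)) (Ico (0 : ℝ) te) t)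
    {a η G : ℝ} (ha : 0 ≤ a) (hη : 0 < η) (hae : a + η < te) (u : E)
    (hG : ‖gradient f u‖ ≤ G) :
    ‖(u - η • gradient f u) - θ (a + η)‖ ≤ gronwallBound ‖u - θ a‖ m (β * η * G) η := by
  set g := gradient f u
  have hder : ∀ t ∈ Ico a (a + η), HasDerivWithinAt (fun t => (u - (t - a) • g) - θ t)
      (-g + gradient f (θ t)) (Ici t) t := by
    intro t ht
    have h1 : HasDerivWithinAt (fun t : ℝ => u - (t - a) • g) (-g) (Ici t) t := by
      simpa using ((((hasDerivAt_id t).sub_const a).smul_const g).const_sub u).hasDerivWithinAt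
    have h2 : HasDerivWithinAt θ (-gradient f (θ t)) (Ici t) t := by
      refine (hθ t ⟨ha.trans ht.1, ht.2.trans hae⟩).mono_of_mem_nhdsWithin ?_
      filter_upwards [self_mem_nhdsWithin,
        mem_nhdsWithin_of_mem_nhds (Iio_mem_nhds (ht.2.trans hae))] with z hz hz'
      exact ⟨(ha.trans ht.1).trans hz, hz'⟩
    rw [← sub_neg_eq_add]
    exact h1.sub h2
  have hcont : ContinuousOn (fun t => (u - (t - a) • g) - θ t) (Icc a (a + η)) := by
    refine ContinuousOn.sub (by fun_prop) fun t ht => ?_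
    exact (hθ t ⟨ha.trans ht.1, ht.2.trans_lt hae⟩).continuousWithinAt.mono
      fun z hz => ⟨ha.trans hz.1, hz.2.trans_lt hae⟩
  have hdrift : ∀ t ∈ Ico a (a + η),
      ‖gradient f (u - (t - a) • g) - g‖ ≤ β * η * G := by
    intro t ht
    have ht0 : 0 ≤ t - a := sub_nonneg.mpr ht.1
    calc ‖gradient f (u - (t - a) • g) - g‖
        ≤ β * ‖(u - (t - a) • g) - u‖ := norm_gradient_sub_le hf hsmooth _ _
      _ = β * ((t - a) * ‖g‖) := by
          rw [sub_sub_cancel_left, norm_neg, norm_smul, Real.norm_of_nonneg ht0]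
      _ ≤ β * (η * G) := by
          gcongr
          linarith [ht.2]
      _ = β * η * G := by ring
  have h := norm_le_gronwallBound_of_inner_deriv_right_le (K := m) (ε := β * η * G)
    hcont hder le_rfl ?_ ?_ (a + η) ⟨by linarith, le_rfl⟩
  · simpa using h
  · intro t ht h0
    have h1 := hdrift t ht
    rw [sub_eq_zero.mp h0] at h1
    rwa [neg_add_eq_sub]
  · intro t ht
    have h1 := inner_gradient_sub_ge hf hm (u - (t - a) • g) (θ t)
    have h2 := (real_inner_le_norm (u - (t - a) • g - θ t)
      (gradient f (u - (t - a) • g) - g)).trans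
        (mul_le_mul_of_nonneg_left (hdrift t ht) (norm_nonneg _))
    have h3 : -g + gradient f (θ t) = (gradient f (u - (t - a) • g) - g)
        - (gradient f (u - (t - a) • g) - gradient f (θ t)) := by abel
    rw [h3, inner_sub_right]
    linarith

theorem neg_mul_norm_sq_le_inner_fderiv_gradient
    (hsmooth : ∀ q, ‖fderiv ℝ (gradient f) q‖ ≤ β) (q v : E) :
    sInf {r : ℝ | ∃ q v : E, ‖v‖ = 1 ∧ r = ⟪v, fderiv ℝ (gradient f) q v⟫} * ‖v‖ ^ 2 ≤
      ⟪v, fderiv ℝ (gradient f) q v⟫ := by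
  rcases eq_or_ne v 0 with rfl | hv
  · simp
  have hpos : 0 < ‖v‖ := norm_pos_iff.mpr hv
  have hbdd : BddBelow
      {r : ℝ | ∃ q v : E, ‖v‖ = 1 ∧ r = ⟪v, fderiv ℝ (gradient f) q v⟫} := by
    refine ⟨-β, ?_⟩
    rintro r ⟨p, w, hw, rfl⟩
    have h1 := neg_le_of_abs_le (abs_real_inner_le_norm w (fderiv ℝ (gradient f) p w))
    have h2 := (fderiv ℝ (gradient f) p).le_of_opNorm_le (hsmooth p) w
    rw [hw] at h1 h2
    linarith
  have h := csInf_le hbdd ⟨q, ‖v‖⁻¹ • v, by simp [norm_smul, hpos.ne'], rfl⟩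
  rw [map_smul, real_inner_smul_left, real_inner_smul_right] at h
  calc _ ≤ (‖v‖⁻¹ * (‖v‖⁻¹ * ⟪v, fderiv ℝ (gradient f) q v⟫)) * ‖v‖ ^ 2 := by gcongr
    _ = _ := by field_simp

end GradientFlow

/-- The Grönwall bound with source `η / c` stays below `ε` under the coarse step-size
conditions. -/
theorem gronwallBound_le_of_coarse_step {m c ε e η T : ℝ} (hc : 0 < c) (hη : 0 < η)
    (he : 0 ≤ e) (hT : 0 < T)
    (hneg : m < 0 → η < c * (ε - e) * |m|)
    (hzero : m = 0 → η < c * (ε - e) * (1 / T))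
    (hpos : 0 < m → η < c * (ε - e * Real.exp (m * T)) * (Real.exp (m * T) - 1)⁻¹ * m)
    {t : ℝ} (ht : 0 ≤ t) (htT : t ≤ T) :
    gronwallBound e m (η / c) t ≤ ε := by
  have hδ : 0 < η / c := by positivity
  rcases lt_trichotomy m 0 with hm | hm | hm
  · have h := hneg hm
    rw [abs_of_neg hm, mul_assoc, ← div_lt_iff₀' hc] at h
    have hx1 : Real.exp (m * t) ≤ 1 := Real.exp_le_one_iff.mpr (by nlinarith)
    have hx0 := Real.exp_pos (m * t)
    rw [gronwallBound_of_K_ne_0 hm.ne]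
    have h1 : η / c / (-m) < ε - e := by rwa [div_lt_iff₀ (by linarith)]
    have h2 : 0 < η / c / (-m) := div_pos hδ (by linarith)
    have h3 : η / c / m = -(η / c / (-m)) := by rw [div_neg, neg_neg]
    simp only [h3]
    nlinarith
  · subst hm
    have h := hzero rfl
    rw [mul_one_div, mul_div_assoc, ← div_lt_iff₀' hc, lt_div_iff₀ hT] at h
    rw [gronwallBound_K0]
    have := mul_le_mul_of_nonneg_left htT hδ.le
    simp only
    linarith
  · have h := hpos hm
    refine (gronwallBound_mono he hδ.le hm.le htT).trans ?_
    have hX : 0 < Real.exp (m * T) - 1 := sub_pos.mpr (Real.one_lt_exp_iff.mpr (by positivity))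
    rw [mul_assoc, mul_assoc, ← div_lt_iff₀' hc, inv_mul_eq_div, mul_div_assoc',
      lt_div_iff₀ hX, ← div_lt_iff₀ hm] at h
    rw [gronwallBound_of_K_ne_0 hm.ne']
    simp only
    have h2 : η / c / m * (Real.exp (m * T) - 1) = η / c * (Real.exp (m * T) - 1) / m := by
      ring
    linarith

/-- Corollary 1 of the paper: coarse step-size conditions, according to
the sign of `m := -inf_q λ_min(∇²f(q))`, under which the first `⌊t̃/η⌋` iterates of
gradient descent on a non-negative `β`-smooth objective `ε`-approximate the gradient flow
trajectory up to time `t̃`. -/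
theorem gradient_descent_matches_gradient_flow_coarse {d : ℕ}
    (f : EuclideanSpace ℝ (Fin d) → ℝ) (hf : ContDiff ℝ 2 f)
    (hnonneg : ∀ q, 0 ≤ f q)
    (β : ℝ) (hβ : 0 < β)
    (hsmooth : ∀ q : EuclideanSpace ℝ (Fin d), ‖fderiv ℝ (gradient f) q‖ ≤ β)
    (m : ℝ) (hm : m = -sInf {r : ℝ | ∃ q v : EuclideanSpace ℝ (Fin d),
      ‖v‖ = 1 ∧ r = ⟪v, fderiv ℝ (gradient f) q v⟫})
    (te : ℝ) (θ : ℝ → EuclideanSpace ℝ (Fin d))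
    (hθ : ∀ t ∈ Set.Ico (0 : ℝ) te,
      HasDerivWithinAt θ (-gradient f (θ t)) (Set.Ico (0 : ℝ) te) t)
    (tf : ℝ) (htf0 : 0 < tf) (htfe : tf < te)
    (ε : ℝ) (hε : 0 < ε)
    (θ0 : EuclideanSpace ℝ (Fin d)) (η : ℝ) (hη0 : 0 < η)
    (c : ℝ) (hc : c = (Real.sqrt (2 * β ^ 3 * f (θ 0)) + β ^ 2 * ε)⁻¹)
    (hηneg : m < 0 → η < c * (ε - ‖θ0 - θ 0‖) * |m|)
    (hηzero : m = 0 → η < c * (ε - ‖θ0 - θ 0‖) * (1 / tf))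
    (hηpos : 0 < m → η < c * (ε - ‖θ0 - θ 0‖ * Real.exp (m * tf)) *
      (Real.exp (m * tf) - 1)⁻¹ * m) :
    ∀ k : ℕ, 1 ≤ k → k ≤ ⌊tf / η⌋₊ → ‖gdIter f η θ0 k - θ (k * η)‖ ≤ ε := by
  have hM : ∀ q v, -m * ‖v‖ ^ 2 ≤ ⟪v, fderiv ℝ (gradient f) q v⟫ := fun q v => by
    rw [hm, neg_neg]
    exact neg_mul_norm_sq_le_inner_fderiv_gradient hsmooth q v
  set S := Real.sqrt (2 * β ^ 3 * f (θ 0))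
  have hcpos : 0 < c := by
    rw [hc]
    positivity
  have hflow : ∀ t ∈ Set.Ico (0 : ℝ) te, β * ‖gradient f (θ t)‖ ≤ S := by
    intro t ht
    refine Real.le_sqrt_of_sq_le ?_
    have h1 := norm_gradient_sq_le hf hnonneg hβ hsmooth (θ t)
    have h2 : f (θ t) ≤ f (θ 0) := antitoneOn_comp_gradientFlow
      (hf.differentiable two_ne_zero) hθ ⟨le_rfl, htf0.trans htfe⟩ ht ht.1
    calc (β * ‖gradient f (θ t)‖) ^ 2 = β ^ 2 * ‖gradient f (θ t)‖ ^ 2 := by ring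
      _ ≤ β ^ 2 * (2 * β * f (θ 0)) := by
          gcongr
          exact h1.trans (by gcongr)
      _ = 2 * β ^ 3 * f (θ 0) := by ring
  have hsmall : ∀ t, 0 ≤ t → t ≤ tf → gronwallBound ‖θ0 - θ 0‖ m (η / c) t ≤ ε :=
    fun t ht htT => gronwallBound_le_of_coarse_step hcpos hη0 (norm_nonneg _) htf0
      hηneg hηzero hηpos ht htT
  have hmain : ∀ k : ℕ, k * η ≤ tf →
      ‖gdIter f η θ0 k - θ (k * η)‖ ≤ gronwallBound ‖θ0 - θ 0‖ m (η / c) (k * η) := by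
    intro k
    induction k with
    | zero => simp [gdIter, gronwallBound_x0]
    | succ k ih =>
      intro hk
      have hsucc : ((k + 1 : ℕ) : ℝ) * η = k * η + η := by
        push_cast
        ring
      rw [hsucc] at hk ⊢
      have hk0 : 0 ≤ (k : ℝ) * η := by positivity
      have hkf : (k : ℝ) * η ≤ tf := by linarith
      have ihk := ih hkf
      have hε_k := ihk.trans (hsmall _ hk0 hkf)
      set u := gdIter f η θ0 k
      have hG : ‖gradient f u‖ ≤ (S + β ^ 2 * ε) / β := by
        rw [le_div_iff₀' hβ]
        have h1 := hflow (k * η) ⟨hk0, hkf.trans_lt htfe⟩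
        have h2 := (norm_gradient_sub_le hf hsmooth u (θ (k * η))).trans
          (mul_le_mul_of_nonneg_left hε_k hβ.le)
        have h3 := norm_le_norm_add_norm_sub' (gradient f u) (gradient f (θ (k * η)))
        nlinarith [mul_le_mul_of_nonneg_left (h3.trans (add_le_add_right h2 _)) hβ.le]
      have hstep := norm_gradientDescent_step_sub_gradientFlow_le hf hβ hsmooth hM hθ hk0 hη0
        (hk.trans_lt htfe) u hG
      have hδ : β * η * ((S + β ^ 2 * ε) / β) = η / c := by
        rw [hc, div_inv_eq_mul]
        field_simp
      rw [hδ] at hstep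
      rw [← gronwallBound_gronwallBound]
      refine hstep.trans ?_
      unfold gronwallBound at ihk ⊢
      split_ifs at ihk ⊢ <;> gcongr
  intro k _ hk
  have hkf : (k : ℝ) * η ≤ tf := by
    rw [← le_div_iff₀ hη0]
    exact (Nat.le_floor_iff (by positivity)).mp hk
  exact (hmain k hkf).trans (hsmall _ (by positivity) hkf)
end
end

section
/- For any θ ∈ ℝ^d and any tuple (ΔW_1,…,ΔW_n) ∈ ℝ^{d_1×d_0}×⋯×ℝ^{d_n×d_{n−1}}, the Hessian of the training loss of a deep linear network satisfies: ∇²f(θ)[ΔW_1,…,ΔW_n] = ∇²φ(W_{n:1})[ Σ_{j=1}^{n} W_{n:j+1}·(ΔW_j)·W_{j−1:1} ] + 2·Tr( ∇φ(W_{n:1})ᵀ · Σ_{1≤j<j′≤n} W_{n:j′+1}·(ΔW_{j′})·W_{j′−1:j+1}·(ΔW_j)·W_{j−1:1} ). -/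
open scoped RealInnerProductSpace
open Matrix

noncomputable section

/-- The family of weight matrices of a depth-`n` fully connected network with layer widths
`dims 0, dims 1, …, dims n`: `W j` maps `ℝ^{dims j}` to `ℝ^{dims (j+1)}` (zero-indexed). -/
abbrev WeightFam (n : ℕ) (dims : ℕ → ℕ) : Type :=
  ∀ j : Fin n, Matrix (Fin (dims (j.val + 1))) (Fin (dims j.val)) ℝ

/-- Rectangular matrix with ones on the diagonal: equals the identity matrix whenever the
two dimensions coincide. -/
def castId (p q : ℕ) : Matrix (Fin p) (Fin q) ℝ :=
  Matrix.of fun i j => if (i : ℕ) = (j : ℕ) then 1 else 0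

/-- `segProd dims W a b = W_{b-1} * ⋯ * W_a` (zero-indexed), the identity when `a = b`.
This realizes the paper's product `W_{b : a+1}` (one-indexed), empty products being
identity matrices. -/
def segProd {n : ℕ} (dims : ℕ → ℕ) (W : WeightFam n dims) (a : ℕ) :
    (b : ℕ) → Matrix (Fin (dims b)) (Fin (dims a)) ℝ
  | 0 => castId (dims 0) (dims a)
  | b + 1 =>
      if a = b + 1 then castId (dims (b + 1)) (dims a)
      else if hb : b < n then W ⟨b, hb⟩ * segProd dims W a b else 0

/-- Multiplication of a Euclidean vector by a matrix. -/
def mulVecE {p q : ℕ} (M : Matrix (Fin p) (Fin q) ℝ) (v : EuclideanSpace ℝ (Fin q)) :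
    EuclideanSpace ℝ (Fin p) :=
  (EuclideanSpace.equiv (Fin p) ℝ).symm (M.mulVec (EuclideanSpace.equiv (Fin q) ℝ v))

/-- The space of `p × q` real matrices regarded as a Euclidean space (so that the Euclidean
norm is the Frobenius norm). -/
abbrev MatE (p q : ℕ) : Type := EuclideanSpace ℝ (Fin p × Fin q)

/-- Conversion from the Euclidean representation to the matrix itself. -/
def toMat {p q : ℕ} (w : MatE p q) : Matrix (Fin p) (Fin q) ℝ :=
  Matrix.of fun i j => w (i, j)

/-- Conversion from a matrix to its Euclidean representation. -/
def ofMat {p q : ℕ} (M : Matrix (Fin p) (Fin q) ℝ) : MatE p q :=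
  (EuclideanSpace.equiv (Fin p × Fin q) ℝ).symm fun ij => M ij.1 ij.2

/-- The Hessian of `f` at `x`, regarded as a quadratic form, evaluated at `v`. -/
def hessQ {E : Type*} [NormedAddCommGroup E] [InnerProductSpace ℝ E] [CompleteSpace E]
    (f : E → ℝ) (x v : E) : ℝ :=
  ⟪v, fderiv ℝ (gradient f) x v⟫

/-- `φ(W) = (1/|S|) ∑ᵢ ℓ(W xᵢ, yᵢ)`, as a function of the Euclidean representation of the
matrix `W`. -/
def phiE {Y : Type*} {s : ℕ} (n : ℕ) (dims : ℕ → ℕ)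
    (loss : EuclideanSpace ℝ (Fin (dims n)) → Y → ℝ)
    (x : Fin s → EuclideanSpace ℝ (Fin (dims 0))) (y : Fin s → Y)
    (w : MatE (dims n) (dims 0)) : ℝ :=
  (1 / (s : ℝ)) * ∑ i, loss (mulVecE (toMat w) (x i)) (y i)

/-- The training loss of the deep linear network: `f θ = φ (W_{n:1})`. -/
def linLoss {Y : Type*} {s : ℕ} {n d : ℕ} (dims : ℕ → ℕ)
    (loss : EuclideanSpace ℝ (Fin (dims n)) → Y → ℝ)
    (x : Fin s → EuclideanSpace ℝ (Fin (dims 0))) (y : Fin s → Y)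
    (arr : EuclideanSpace ℝ (Fin d) →ₗ[ℝ] WeightFam n dims)
    (θ : EuclideanSpace ℝ (Fin d)) : ℝ :=
  phiE n dims loss x y (ofMat (segProd dims (arr θ) 0 n))

section Hessian

variable {E : Type*} [NormedAddCommGroup E] [InnerProductSpace ℝ E]

theorem ContDiff.differentiable_fderiv {F : E → ℝ} (hF : ContDiff ℝ 2 F) :
    Differentiable ℝ (fderiv ℝ F) :=
  (hF.fderiv_right (m := 1) (by norm_num)).differentiable (by norm_num)

variable [CompleteSpace E]

theorem hessQ_eq_fderiv_fderiv {F : E → ℝ} (hF : ContDiff ℝ 2 F) (x v : E) :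
    hessQ F x v = fderiv ℝ (fderiv ℝ F) x v v := by
  have h : HasFDerivAt (fun z => ⟪v, gradient F z⟫) (innerSL ℝ v ∘L fderiv ℝ (gradient F) x) x := by
    have hg : DifferentiableAt ℝ (gradient F) x :=
      ((InnerProductSpace.toDual ℝ E).symm.toContinuousLinearEquiv.differentiable.comp
        hF.differentiable_fderiv) x
    exact (innerSL ℝ v).hasFDerivAt.comp x hg.hasFDerivAt
  have hdual : HasFDerivAt (fun z => ⟪v, gradient F z⟫)
      (ContinuousLinearMap.apply ℝ ℝ v ∘L fderiv ℝ (fderiv ℝ F) x) x := by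
    have := (ContinuousLinearMap.apply ℝ ℝ v).hasFDerivAt.comp x
      (hF.differentiable_fderiv x).hasFDerivAt
    refine this.congr_of_eventuallyEq (Filter.Eventually.of_forall fun z => ?_)
    simp [inner_gradient_right]
  simpa [hessQ] using DFunLike.congr_fun (h.unique hdual) v

/-- Second-order chain rule along a curve. -/
theorem hasDerivAt_fderiv_comp_curve {F : E → ℝ} (hF : ContDiff ℝ 2 F) {c c' : ℝ → E} {c'' : E}
    {t : ℝ} (hc : HasDerivAt c (c' t) t) (hc' : HasDerivAt c' c'' t) :
    HasDerivAt (fun u => fderiv ℝ F (c u) (c' u))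
      (hessQ F (c t) (c' t) + fderiv ℝ F (c t) c'') t := by
  rw [hessQ_eq_fderiv_fderiv hF]
  exact ((hF.differentiable_fderiv (c t)).hasFDerivAt.comp_hasDerivAt t hc).clm_apply hc'

end Hessian

theorem hasDerivAt_matrix_mul_apply {l m p : Type*} [Fintype m] {A : ℝ → Matrix l m ℝ}
    {B : ℝ → Matrix m p ℝ} {A' : Matrix l m ℝ} {B' : Matrix m p ℝ} {t : ℝ}
    (hA : ∀ i j, HasDerivAt (fun u => A u i j) (A' i j) t)
    (hB : ∀ i j, HasDerivAt (fun u => B u i j) (B' i j) t) (i : l) (j : p) :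
    HasDerivAt (fun u => (A u * B u) i j) ((A' * B t + A t * B') i j) t := by
  simp only [Matrix.add_apply, Matrix.mul_apply, ← Finset.sum_add_distrib]
  exact HasDerivAt.fun_sum fun k _ => (hA i k).fun_mul (hB k j)

section SegProd

variable {n : ℕ} (dims : ℕ → ℕ)

theorem castId_self (p : ℕ) : castId p p = 1 := by
  ext i j
  simp [castId, Matrix.one_apply, Fin.ext_iff]

theorem segProd_self (W : WeightFam n dims) (a : ℕ) : segProd dims W a a = 1 := by
  cases a <;> simp [segProd, castId_self]

theorem segProd_succ (W : WeightFam n dims) {a b : ℕ} (hab : a ≤ b) (hb : b < n) :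
    segProd dims W a (b + 1) = W ⟨b, hb⟩ * segProd dims W a b := by
  have : a ≠ b + 1 := by omega
  simp [segProd, this, hb]

/-- The derivative of `W ↦ segProd dims W a b` in the direction `V`. -/
def segDeriv (W V : WeightFam n dims) (a b : ℕ) : Matrix (Fin (dims b)) (Fin (dims a)) ℝ :=
  ∑ j : Fin n, if a ≤ j.val ∧ j.val < b then
    segProd dims W (j.val + 1) b * V j * segProd dims W a j.val else 0

theorem segDeriv_self (W V : WeightFam n dims) (a : ℕ) : segDeriv dims W V a a = 0 := by
  refine Finset.sum_eq_zero fun j _ => if_neg ?_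
  omega

theorem segDeriv_succ (W V : WeightFam n dims) {a b : ℕ} (hab : a ≤ b) (hb : b < n) :
    segDeriv dims W V a (b + 1) =
      V ⟨b, hb⟩ * segProd dims W a b + W ⟨b, hb⟩ * segDeriv dims W V a b := by
  have key : ∀ j : Fin n,
      (if a ≤ j.val ∧ j.val < b + 1 then
        segProd dims W (j.val + 1) (b + 1) * V j * segProd dims W a j.val else 0) =
      (if j = ⟨b, hb⟩ then
        segProd dims W (j.val + 1) (b + 1) * V j * segProd dims W a j.val else 0) +
      W ⟨b, hb⟩ * (if a ≤ j.val ∧ j.val < b then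
        segProd dims W (j.val + 1) b * V j * segProd dims W a j.val else 0) := by
    intro j
    rcases lt_trichotomy j.val b with h | h | h
    · have h1 : j ≠ ⟨b, hb⟩ := fun e => h.ne (congrArg Fin.val e)
      have h2 : j.val < b + 1 := by omega
      simp only [h, h1, h2, and_true, if_false, zero_add]
      split_ifs
      · rw [segProd_succ dims W h hb]
        simp only [Matrix.mul_assoc]
      · simp
    · have h1 : j = ⟨b, hb⟩ := Fin.ext h
      have h2 : a ≤ j.val ∧ j.val < b + 1 := by omega
      have h3 : ¬ (a ≤ j.val ∧ j.val < b) := by omega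
      rw [if_pos h1, if_pos h2, if_neg h3, Matrix.mul_zero, add_zero]
    · have h1 : j ≠ ⟨b, hb⟩ := fun e => h.ne' (congrArg Fin.val e)
      have h2 : ¬ (a ≤ j.val ∧ j.val < b + 1) := by omega
      have h3 : ¬ (a ≤ j.val ∧ j.val < b) := by omega
      rw [if_neg h1, if_neg h2, if_neg h3, Matrix.mul_zero, add_zero]
  rw [segDeriv, Finset.sum_congr rfl fun j _ => key j, Finset.sum_add_distrib,
    Finset.sum_ite_eq' Finset.univ, if_pos (Finset.mem_univ _), ← Matrix.mul_sum, segDeriv,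
    segProd_self, Matrix.one_mul]

variable {dims}

theorem hasDerivAt_segProd {W : ℝ → WeightFam n dims} {V : WeightFam n dims} {t : ℝ}
    (hW : ∀ k i j, HasDerivAt (fun u => W u k i j) (V k i j) t) {a b : ℕ} (hab : a ≤ b)
    (hb : b ≤ n) (i : Fin (dims b)) (j : Fin (dims a)) :
    HasDerivAt (fun u => segProd dims (W u) a b i j) (segDeriv dims (W t) V a b i j) t := by
  induction b, hab using Nat.le_induction generalizing j with
  | base =>
    simp only [segProd_self, segDeriv_self]
    exact hasDerivAt_const t _
  | succ b hab ih =>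
    simp only [segProd_succ dims _ hab hb, segDeriv_succ dims _ _ hab hb]
    exact hasDerivAt_matrix_mul_apply (hW ⟨b, hb⟩) (fun p q => ih (by omega) p q) i j

theorem contDiff_segProd {E : Type*} [NormedAddCommGroup E] [NormedSpace ℝ E]
    {m : WithTop ℕ∞} {W : E → WeightFam n dims} (hW : ∀ k i j, ContDiff ℝ m fun z => W z k i j)
    {a b : ℕ} (hab : a ≤ b) (hb : b ≤ n) (i : Fin (dims b)) (j : Fin (dims a)) :
    ContDiff ℝ m fun z => segProd dims (W z) a b i j := by
  induction b, hab using Nat.le_induction with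
  | base =>
    simp only [segProd_self]
    exact contDiff_const
  | succ b hab ih =>
    simp only [segProd_succ dims _ hab hb, Matrix.mul_apply]
    exact ContDiff.sum fun k _ => (hW _ _ _).mul (ih (by omega) k)

variable (dims)

/-- Half of the second derivative of `W ↦ segProd dims W 0 n` in the direction `V`. -/
def segCross (W V : WeightFam n dims) : Matrix (Fin (dims n)) (Fin (dims 0)) ℝ :=
  ∑ j' : Fin n, ∑ j : Fin n,
    if j.val < j'.val then
      segProd dims W (j'.val + 1) n * V j' *
        segProd dims W (j.val + 1) j'.val * V j * segProd dims W 0 j.val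
    else 0

theorem sum_segDeriv_eq_two_smul_segCross (W V : WeightFam n dims) :
    ∑ j : Fin n, (segDeriv dims W V (j.val + 1) n * V j * segProd dims W 0 j.val +
      segProd dims W (j.val + 1) n * V j * segDeriv dims W V 0 j.val) =
    (2 : ℝ) • segCross dims W V := by
  rw [Finset.sum_add_distrib, two_smul]
  congr 1
  · rw [segCross, Finset.sum_comm]
    refine Finset.sum_congr rfl fun j _ => ?_
    rw [segDeriv, Matrix.sum_mul, Matrix.sum_mul]
    refine Finset.sum_congr rfl fun j' _ => ?_
    by_cases h : j.val < j'.val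
    · rw [if_pos h, if_pos ⟨h, j'.isLt⟩]
    · rw [if_neg h, if_neg fun h' => h h'.1, Matrix.zero_mul, Matrix.zero_mul]
  · refine Finset.sum_congr rfl fun j _ => ?_
    rw [segDeriv, Matrix.mul_sum]
    refine Finset.sum_congr rfl fun i _ => ?_
    by_cases h : i.val < j.val
    · rw [if_pos h, if_pos ⟨Nat.zero_le _, h⟩]
      simp only [Matrix.mul_assoc]
    · rw [if_neg h, if_neg fun h' => h h'.2, Matrix.mul_zero]

variable {dims}

theorem segDeriv_zero (W V : WeightFam n dims) :
    segDeriv dims W V 0 n =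
      ∑ j : Fin n, segProd dims W (j.val + 1) n * V j * segProd dims W 0 j.val :=
  Finset.sum_congr rfl fun j _ => if_pos ⟨Nat.zero_le _, j.isLt⟩

theorem hasDerivAt_segDeriv {W : ℝ → WeightFam n dims} {V : WeightFam n dims} {t : ℝ}
    (hW : ∀ k i j, HasDerivAt (fun u => W u k i j) (V k i j) t)
    (i : Fin (dims n)) (j : Fin (dims 0)) :
    HasDerivAt (fun u => segDeriv dims (W u) V 0 n i j) (((2 : ℝ) • segCross dims (W t) V) i j) t := by
  simp only [← sum_segDeriv_eq_two_smul_segCross, segDeriv_zero, Matrix.sum_apply]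
  refine HasDerivAt.fun_sum fun k _ => ?_
  refine hasDerivAt_matrix_mul_apply (fun p q => ?_)
    (hasDerivAt_segProd hW (Nat.zero_le _) k.isLt.le) i j
  have := hasDerivAt_matrix_mul_apply (B := fun _ => V k) (B' := 0)
    (hasDerivAt_segProd hW (Nat.succ_le_of_lt k.isLt) le_rfl) (fun _ _ => hasDerivAt_const t _) p q
  simpa using this

end SegProd

theorem hasDerivAt_ofMat {p q : ℕ} {A : ℝ → Matrix (Fin p) (Fin q) ℝ} {A' : Matrix (Fin p) (Fin q) ℝ}
    {t : ℝ} (hA : ∀ i j, HasDerivAt (fun u => A u i j) (A' i j) t) :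
    HasDerivAt (fun u => ofMat (A u)) (ofMat A') t :=
  (EuclideanSpace.equiv (Fin p × Fin q) ℝ).symm.hasFDerivAt.comp_hasDerivAt t
    (hasDerivAt_pi.2 fun ij => hA ij.1 ij.2)

theorem ofMat_smul {p q : ℕ} (r : ℝ) (A : Matrix (Fin p) (Fin q) ℝ) :
    ofMat (r • A) = r • ofMat A := rfl

theorem trace_transpose_toMat_mul {p q : ℕ} (g : MatE p q) (A : Matrix (Fin p) (Fin q) ℝ) :
    Matrix.trace ((toMat g)ᵀ * A) = ⟪g, ofMat A⟫ := by
  simp only [Matrix.trace, Matrix.diag, Matrix.mul_apply, Matrix.transpose_apply,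
    PiLp.inner_apply, Fintype.sum_prod_type]
  rw [Finset.sum_comm]
  exact Finset.sum_congr rfl fun i _ => Finset.sum_congr rfl fun j _ => mul_comm _ _

theorem contDiff_phiE {Y : Type*} {s : ℕ} (n : ℕ) (dims : ℕ → ℕ)
    {loss : EuclideanSpace ℝ (Fin (dims n)) → Y → ℝ} {m : WithTop ℕ∞}
    (hloss : ∀ yy : Y, ContDiff ℝ m fun v => loss v yy)
    (x : Fin s → EuclideanSpace ℝ (Fin (dims 0))) (y : Fin s → Y) :
    ContDiff ℝ m (phiE n dims loss x y) := by
  refine contDiff_const.mul (ContDiff.sum fun i _ => (hloss (y i)).comp ?_)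
  refine contDiff_euclidean.2 fun k => ?_
  change ContDiff ℝ m fun w : MatE (dims n) (dims 0) => ∑ j, w (k, j) * x i j
  fun_prop

/-- Lemma 1 of the paper: the Hessian of the training loss of a deep
linear neural network, as a quadratic form on tuples of weight-matrix perturbations. -/
theorem deep_linear_hessian_formula {n d : ℕ} (hn : 2 ≤ n) (dims : ℕ → ℕ)
    {Y : Type*} (s : ℕ) (hs : 0 < s)
    (x : Fin s → EuclideanSpace ℝ (Fin (dims 0))) (y : Fin s → Y)
    (loss : EuclideanSpace ℝ (Fin (dims n)) → Y → ℝ)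
    (hconv : ∀ yy : Y, ConvexOn ℝ Set.univ (fun v => loss v yy))
    (hsm : ∀ yy : Y, ContDiff ℝ 2 (fun v => loss v yy))
    (arr : EuclideanSpace ℝ (Fin d) →ₗ[ℝ] WeightFam n dims)
    (harr : Function.Bijective arr)
    (hinner : ∀ u v : EuclideanSpace ℝ (Fin d), ⟪u, v⟫ =
      ∑ j : Fin n, ∑ p : Fin (dims (j.val + 1)), ∑ q : Fin (dims j.val),
        arr u j p q * arr v j p q)
    (θ dθ : EuclideanSpace ℝ (Fin d)) :
    hessQ (linLoss dims loss x y arr) θ dθ =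
      hessQ (phiE n dims loss x y) (ofMat (segProd dims (arr θ) 0 n))
        (ofMat (∑ j : Fin n,
          segProd dims (arr θ) (j.val + 1) n * arr dθ j * segProd dims (arr θ) 0 j.val)) +
      2 * Matrix.trace
          ((toMat (gradient (phiE n dims loss x y) (ofMat (segProd dims (arr θ) 0 n))))ᵀ *
            ∑ j' : Fin n, ∑ j : Fin n,
              if j.val < j'.val then
                segProd dims (arr θ) (j'.val + 1) n * arr dθ j' *
                  segProd dims (arr θ) (j.val + 1) j'.val * arr dθ j *
                  segProd dims (arr θ) 0 j.val
              else 0) := by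
  set φ := phiE n dims loss x y
  have hφ : ContDiff ℝ 2 φ := contDiff_phiE n dims hsm x y
  have harr_smooth : ∀ k i j, ContDiff ℝ 2 fun z => arr z k i j := fun k i j =>
    (LinearMap.toContinuousLinearMap
      (LinearMap.proj j ∘ₗ LinearMap.proj i ∘ₗ LinearMap.proj k ∘ₗ arr :
        EuclideanSpace ℝ (Fin d) →ₗ[ℝ] ℝ)).contDiff
  have hf : ContDiff ℝ 2 (linLoss dims loss x y arr) :=
    hφ.comp (contDiff_euclidean.2 fun ij =>
      contDiff_segProd harr_smooth (Nat.zero_le n) le_rfl ij.1 ij.2)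
  let c : ℝ → EuclideanSpace ℝ (Fin d) := fun t => θ + t • dθ
  have hc : ∀ t, HasDerivAt c dθ t := fun t => by
    simpa only [one_smul] using ((hasDerivAt_id' t).smul_const dθ).const_add θ
  have hc0 : c 0 = θ := by simp [c]
  have hW : ∀ t k i j, HasDerivAt (fun u => arr (c u) k i j) (arr dθ k i j) t := by
    intro t k i j
    have : HasDerivAt (fun u : ℝ => arr θ k i j + u * arr dθ k i j) (arr dθ k i j) t := by
      simpa using ((hasDerivAt_id t).mul_const (arr dθ k i j)).const_add (arr θ k i j)
    simpa [c] using this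
  have hP : ∀ t, HasDerivAt (fun u => ofMat (segProd dims (arr (c u)) 0 n))
      (ofMat (segDeriv dims (arr (c t)) (arr dθ) 0 n)) t := fun t =>
    hasDerivAt_ofMat (hasDerivAt_segProd (hW t) (Nat.zero_le n) le_rfl)
  have hP' := hasDerivAt_ofMat (hasDerivAt_segDeriv (hW 0))
  have hfirst : ∀ t, fderiv ℝ (linLoss dims loss x y arr) (c t) dθ =
      fderiv ℝ φ (ofMat (segProd dims (arr (c t)) 0 n))
        (ofMat (segDeriv dims (arr (c t)) (arr dθ) 0 n)) := fun t =>
    ((hf.differentiable (by norm_num) (c t)).hasFDerivAt.comp_hasDerivAt t (hc t)).unique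
      ((hφ.differentiable (by norm_num) _).hasFDerivAt.comp_hasDerivAt t (hP t))
  have h1 := hasDerivAt_fderiv_comp_curve hf (c' := fun _ => dθ) (hc 0) (hasDerivAt_const 0 dθ)
  have h2 := hasDerivAt_fderiv_comp_curve hφ
    (c' := fun u => ofMat (segDeriv dims (arr (c u)) (arr dθ) 0 n)) (hP 0) hP'
  simp only [hfirst] at h1
  have h := h1.unique h2
  rw [map_zero, add_zero, hc0, ofMat_smul, map_smul, smul_eq_mul, ← inner_gradient_left,
    ← trace_transpose_toMat_mul, segDeriv_zero] at h
  exact h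
end
end

section
/- For the training loss f of the non-linear fully connected network, assume: (i) the network is deep (n ≥ 3); and (ii) there exists a weight setting θ ∈ ℝ^d for which Σ_{i=1}^{|S|} ∇ℓ(0, y_i)ᵀ h_θ(x_i) ≠ 0, where ∇ℓ(·,·) is the gradient of ℓ with respect to its first argument. Then the infimum, over all θ ∈ ℝ^d at which f is twice continuously differentiable (on a neighborhood of θ), of λ_min(∇²f(θ)) equals −∞. -/
open scoped RealInnerProductSpace
open Matrix

noncomputable section

/-- The homogeneous activation `σ(z) = α·max{z,0} - α'·max{-z,0}`. -/
def actFn (α α' : ℝ) (z : ℝ) : ℝ := α * max z 0 - α' * max (-z) 0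

/-- Entrywise application of the activation. -/
def actVec (α α' : ℝ) {p : ℕ} (v : EuclideanSpace ℝ (Fin p)) : EuclideanSpace ℝ (Fin p) :=
  (EuclideanSpace.equiv (Fin p) ℝ).symm fun i => actFn α α' (v i)

/-- Forward pass of the network: the output of layer `k` on input `x`, the activation being
applied after every layer except the last one. -/
def layerOut {n : ℕ} (α α' : ℝ) (dims : ℕ → ℕ) (W : WeightFam n dims)
    (x : EuclideanSpace ℝ (Fin (dims 0))) : (k : ℕ) → EuclideanSpace ℝ (Fin (dims k))
  | 0 => x
  | k + 1 =>
      if hk : k < n then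
        if k + 1 = n then mulVecE (W ⟨k, hk⟩) (layerOut α α' dims W x k)
        else actVec α α' (mulVecE (W ⟨k, hk⟩) (layerOut α α' dims W x k))
      else 0

/-- The training loss of the fully connected neural network with activation `σ`:
`f(θ) = (1/|S|) ∑ᵢ ℓ(h_θ(xᵢ), yᵢ)`. -/
def netLossNL {Y : Type*} {s : ℕ} {n d : ℕ} (dims : ℕ → ℕ) (α α' : ℝ)
    (loss : EuclideanSpace ℝ (Fin (dims n)) → Y → ℝ)
    (x : Fin s → EuclideanSpace ℝ (Fin (dims 0))) (y : Fin s → Y)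
    (arr : EuclideanSpace ℝ (Fin d) →ₗ[ℝ] WeightFam n dims)
    (θ : EuclideanSpace ℝ (Fin d)) : ℝ :=
  (1 / (s : ℝ)) * ∑ i, loss (layerOut α α' dims (arr θ) (x i) n) (y i)

/-- `segProdD dims W D a b = (D_b W_{b-1}) · (D_{b-1} W_{b-2}) ⋯ (D_{a+1} W_a)`
(zero-indexed weight matrices, `D k` being the diagonal entries of the activation-pattern
matrix at level `k`): the paper's fixed-pattern product `(D'_{i,*} W_*)_{b : a+1}`
(one-indexed), empty products being identity matrices. -/
def segProdD {n : ℕ} (dims : ℕ → ℕ) (W : WeightFam n dims)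
    (D : (j : ℕ) → Fin (dims j) → ℝ) (a : ℕ) :
    (b : ℕ) → Matrix (Fin (dims b)) (Fin (dims a)) ℝ
  | 0 => castId (dims 0) (dims a)
  | b + 1 =>
      if a = b + 1 then castId (dims (b + 1)) (dims a)
      else if hb : b < n then
        Matrix.diagonal (D (b + 1)) * W ⟨b, hb⟩ * segProdD dims W D a b
      else 0

/-- The fixed-activation-pattern loss
`θ ↦ (1/|S|) ∑ᵢ ℓ((D'_{i,*}W_*)_{n:1} xᵢ, yᵢ)`. -/
def patLoss {Y : Type*} {s : ℕ} {n d : ℕ} (dims : ℕ → ℕ)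
    (loss : EuclideanSpace ℝ (Fin (dims n)) → Y → ℝ)
    (x : Fin s → EuclideanSpace ℝ (Fin (dims 0))) (y : Fin s → Y)
    (D : Fin s → (j : ℕ) → Fin (dims j) → ℝ)
    (arr : EuclideanSpace ℝ (Fin d) →ₗ[ℝ] WeightFam n dims)
    (θ : EuclideanSpace ℝ (Fin d)) : ℝ :=
  (1 / (s : ℝ)) * ∑ i, loss (mulVecE (segProdD dims (arr θ) (D i) 0 n) (x i)) (y i)

/-- Frobenius norm of a matrix. -/
def frobNorm {p q : ℕ} (M : Matrix (Fin p) (Fin q) ℝ) : ℝ :=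
  Real.sqrt (∑ i, ∑ j, M i j ^ 2)

lemma mulVecE_apply {p q : ℕ} (M : Matrix (Fin p) (Fin q) ℝ) (v : EuclideanSpace ℝ (Fin q))
    (i : Fin p) : mulVecE M v i = ∑ j, M i j * v j := rfl

lemma actVec_apply (α α' : ℝ) {p : ℕ} (v : EuclideanSpace ℝ (Fin p)) (i : Fin p) :
    actVec α α' v i = actFn α α' (v i) := rfl

lemma mulVecE_smul_smul {p q : ℕ} (t r : ℝ) (M : Matrix (Fin p) (Fin q) ℝ)
    (v : EuclideanSpace ℝ (Fin q)) : mulVecE (t • M) (r • v) = (r * t) • mulVecE M v := by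
  ext i
  simp only [mulVecE_apply, PiLp.smul_apply, Matrix.smul_apply, smul_eq_mul, Finset.mul_sum]
  exact Finset.sum_congr rfl fun j _ => by ring

lemma actFn_mul (α α' : ℝ) {r : ℝ} (hr : 0 ≤ r) (z : ℝ) :
    actFn α α' (r * z) = r * actFn α α' z := by
  have h₁ : max (r * z) 0 = r * max z 0 := by simp [mul_max_of_nonneg _ _ hr]
  have h₂ : max (-(r * z)) 0 = r * max (-z) 0 := by simp [mul_max_of_nonneg _ _ hr]
  rw [actFn, actFn, h₁, h₂]
  ring

lemma actVec_smul (α α' : ℝ) {p : ℕ} {r : ℝ} (hr : 0 ≤ r) (v : EuclideanSpace ℝ (Fin p)) :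
    actVec α α' (r • v) = r • actVec α α' v := by
  ext i
  simp only [actFn_mul α α' hr, actVec_apply, PiLp.smul_apply, smul_eq_mul]

/-- The network is homogeneous in each weight matrix separately; the scaling factor of the last
one, which is not followed by an activation, may have any sign. -/
lemma layerOut_smul {n : ℕ} (α α' : ℝ) (dims : ℕ → ℕ) (W : WeightFam n dims)
    (x : EuclideanSpace ℝ (Fin (dims 0))) (t : ℕ → ℝ) (ht : ∀ j, j + 1 < n → 0 ≤ t j) (k : ℕ) :
    layerOut α α' dims (fun j : Fin n => t j • W j) x k =
      (∏ j ∈ Finset.range k, t j) • layerOut α α' dims W x k := by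
  induction k with
  | zero => simp [layerOut]
  | succ k ih =>
    simp only [layerOut]
    split_ifs with hk hk'
    · rw [ih, mulVecE_smul_smul, Finset.prod_range_succ]
    · rw [ih, mulVecE_smul_smul, ← Finset.prod_range_succ, actVec_smul]
      refine Finset.prod_nonneg fun j hj => ht j ?_
      have := Finset.mem_range.1 hj
      omega
    · simp

lemma continuous_actFn (α α' : ℝ) : Continuous (actFn α α') := by
  unfold actFn
  fun_prop

lemma eventually_residual_contDiffAt_actFn {E : Type*} [NormedAddCommGroup E] [NormedSpace ℝ E]
    (α α' : ℝ) {u : E → ℝ} (hu : Continuous u) (h : ∀ᶠ θ in residual E, ContDiffAt ℝ 2 u θ) :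
    ∀ᶠ θ in residual E, ContDiffAt ℝ 2 (fun θ => actFn α α' (u θ)) θ := by
  have hcl : IsClosed {θ | u θ = 0} := isClosed_eq hu continuous_const
  have hfr : (frontier {θ | u θ = 0})ᶜ ∈ residual E :=
    residual_of_dense_open isClosed_frontier.isOpen_compl
      (interior_eq_empty_iff_dense_compl.1 (interior_frontier hcl))
  filter_upwards [h, hfr] with θ hθ hθ'
  rcases lt_trichotomy (u θ) 0 with hneg | hzero | hpos
  · refine (contDiffAt_const.mul hθ : ContDiffAt ℝ 2 (fun θ => α' * u θ) θ).congr_of_eventuallyEq ?_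
    filter_upwards [hu.continuousAt.eventually_lt continuousAt_const hneg] with η hη
    simp [actFn, max_eq_right hη.le, max_eq_left (neg_nonneg.2 hη.le)]
  · have hint : θ ∈ interior {θ | u θ = 0} := by
      by_contra hθi
      exact hθ' ⟨subset_closure hzero, hθi⟩
    refine (contDiffAt_const : ContDiffAt ℝ 2 (fun _ => (0 : ℝ)) θ).congr_of_eventuallyEq ?_
    filter_upwards [mem_interior_iff_mem_nhds.1 hint] with η hη
    have hη : u η = 0 := hη
    simp [actFn, hη]
  · refine (contDiffAt_const.mul hθ : ContDiffAt ℝ 2 (fun θ => α * u θ) θ).congr_of_eventuallyEq ?_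
    filter_upwards [continuousAt_const.eventually_lt hu.continuousAt hpos] with η hη
    simp [actFn, max_eq_left hη.le, max_eq_right (neg_nonpos.2 hη.le)]

lemma layerOut_regular {E : Type*} [NormedAddCommGroup E] [NormedSpace ℝ E] {n : ℕ} (α α' : ℝ)
    (dims : ℕ → ℕ) (A : E → WeightFam n dims) (hA : ∀ j p q, ContDiff ℝ 2 fun θ => A θ j p q)
    (x : EuclideanSpace ℝ (Fin (dims 0))) (k : ℕ) (p : Fin (dims k)) :
    Continuous (fun θ => layerOut α α' dims (A θ) x k p) ∧
      ∀ᶠ θ in residual E, ContDiffAt ℝ 2 (fun θ => layerOut α α' dims (A θ) x k p) θ := by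
  induction k with
  | zero =>
    simp only [layerOut]
    exact ⟨continuous_const, .of_forall fun θ => contDiffAt_const⟩
  | succ k ih =>
    by_cases hk : k < n
    · have hc : Continuous
          (fun θ => mulVecE (A θ ⟨k, hk⟩) (layerOut α α' dims (A θ) x k) p) := by
        simp only [mulVecE_apply]
        exact continuous_finsetSum _ fun q _ => (hA ⟨k, hk⟩ p q).continuous.mul (ih q).1
      have hd : ∀ᶠ θ in residual E, ContDiffAt ℝ 2
          (fun θ => mulVecE (A θ ⟨k, hk⟩) (layerOut α α' dims (A θ) x k) p) θ := by
        simp only [mulVecE_apply]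
        filter_upwards [Filter.eventually_all.2 fun q => (ih q).2] with θ hθ
        exact ContDiffAt.sum fun q _ => (hA ⟨k, hk⟩ p q).contDiffAt.mul (hθ q)
      by_cases hk' : k + 1 = n
      · simpa only [layerOut, dif_pos hk, if_pos hk'] using ⟨hc, hd⟩
      · simp only [layerOut, dif_pos hk, if_neg hk', actVec_apply]
        exact ⟨(continuous_actFn α α').comp hc, eventually_residual_contDiffAt_actFn α α' hc hd⟩
    · simp only [layerOut, dif_neg hk]
      exact ⟨continuous_const, .of_forall fun θ => contDiffAt_const⟩

section Hessian

variable {E : Type*} [NormedAddCommGroup E] [InnerProductSpace ℝ E] [CompleteSpace E]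

lemma hasDerivAt_comp_line {f : E → ℝ} {θ V : E} {ε : ℝ}
    (hf : DifferentiableAt ℝ f (θ + ε • V)) :
    HasDerivAt (fun ε : ℝ => f (θ + ε • V)) ⟪V, gradient f (θ + ε • V)⟫ ε := by
  have hl : HasDerivAt (fun ε : ℝ => θ + ε • V) V ε := by
    simpa using ((hasDerivAt_id ε).smul_const V).const_add θ
  have := hf.hasFDerivAt.comp_hasDerivAt ε hl
  rwa [← real_inner_comm, gradient, InnerProductSpace.toDual_symm_apply]

lemma ContDiffAt.differentiableAt_gradient {f : E → ℝ} {θ : E} (hf : ContDiffAt ℝ 2 f θ) :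
    DifferentiableAt ℝ (gradient f) θ := by
  have h : DifferentiableAt ℝ (fderiv ℝ f) θ :=
    (hf.fderiv_right (m := 1) (by norm_num)).differentiableAt (by norm_num)
  exact (InnerProductSpace.toDual ℝ E).symm.toContinuousLinearEquiv.differentiableAt.comp θ h

lemma hessQ_eq_of_line {f : E → ℝ} {θ V : E} (hf : ContDiffAt ℝ 2 f θ) {ψ' : ℝ → ℝ} {b : ℝ}
    (hψ : ∀ᶠ ε in nhds (0 : ℝ), HasDerivAt (fun ε : ℝ => f (θ + ε • V)) (ψ' ε) ε)
    (hψ' : HasDerivAt ψ' b 0) : hessQ f θ V = b := by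
  have hl : HasDerivAt (fun ε : ℝ => θ + ε • V) V 0 := by
    simpa using ((hasDerivAt_id (0 : ℝ)).smul_const V).const_add θ
  have hev : ∀ᶠ ε in nhds (0 : ℝ), DifferentiableAt ℝ f (θ + ε • V) := by
    have h : ∀ᶠ η in nhds θ, DifferentiableAt ℝ f η :=
      (hf.eventually (by simp)).mono fun η hη => hη.differentiableAt (by norm_num)
    refine hl.continuousAt.eventually ?_
    simpa using h
  have hgrad : HasDerivAt (fun ε : ℝ => ⟪V, gradient f (θ + ε • V)⟫) (hessQ f θ V) 0 := by
    have hg : HasFDerivAt (gradient f) (fderiv ℝ (gradient f) θ) (θ + (0 : ℝ) • V) := by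
      simpa using hf.differentiableAt_gradient.hasFDerivAt
    have hgl := hg.comp_hasDerivAt 0 hl
    exact (innerSL ℝ V).hasFDerivAt.comp_hasDerivAt 0 hgl
  refine hgrad.unique (hψ'.congr_of_eventuallyEq ?_)
  filter_upwards [hψ, hev] with ε h₁ h₂
  exact (hasDerivAt_comp_line h₂).unique h₁

lemma hessQ_smul (f : E → ℝ) (θ V : E) (r : ℝ) :
    hessQ f θ (r • V) = r ^ 2 * hessQ f θ V := by
  simp only [hessQ, map_smul, inner_smul_left, inner_smul_right, conj_trivial]
  ring

end Hessian

lemma hasDerivAt_mul_of_continuousAt {r : ℝ → ℝ} (hr : ContinuousAt r 0) :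
    HasDerivAt (fun ε => ε * r ε) (r 0) 0 := by
  rw [hasDerivAt_iff_tendsto_slope_zero]
  refine (hr.tendsto.mono_left nhdsWithin_le_nhds).congr' ?_
  filter_upwards [self_mem_nhdsWithin] with ε hε
  have hε : ε ≠ 0 := hε
  simp [hε]

/-- Rescaling of the individual weight matrices, as a linear map on parameter space. -/
def layerScale {n d : ℕ} {dims : ℕ → ℕ}
    (e : EuclideanSpace ℝ (Fin d) ≃ₗ[ℝ] WeightFam n dims) (t : ℕ → ℝ) :
    EuclideanSpace ℝ (Fin d) →ₗ[ℝ] EuclideanSpace ℝ (Fin d) :=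
  e.symm.toLinearMap ∘ₗ (LinearMap.pi fun j : Fin n => t j • LinearMap.proj j) ∘ₗ e.toLinearMap

lemma apply_layerScale {n d : ℕ} {dims : ℕ → ℕ}
    (e : EuclideanSpace ℝ (Fin d) ≃ₗ[ℝ] WeightFam n dims) (t : ℕ → ℝ)
    (θ : EuclideanSpace ℝ (Fin d)) : e (layerScale e t θ) = fun j : Fin n => t j • e θ j := by
  simp only [layerScale, LinearMap.comp_apply, LinearEquiv.coe_coe, LinearEquiv.apply_symm_apply]
  rfl

lemma layerScale_layerScale_inv {n d : ℕ} {dims : ℕ → ℕ}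
    (e : EuclideanSpace ℝ (Fin d) ≃ₗ[ℝ] WeightFam n dims) {t u : ℕ → ℝ}
    (htu : ∀ j, t j * u j = 1) (θ : EuclideanSpace ℝ (Fin d)) :
    layerScale e t (layerScale e u θ) = θ := by
  apply e.injective
  simp only [apply_layerScale, smul_smul, htu, one_smul]

lemma layerScale_add_smul {n d : ℕ} {dims : ℕ → ℕ}
    (e : EuclideanSpace ℝ (Fin d) ≃ₗ[ℝ] WeightFam n dims) (t u : ℕ → ℝ) (ε : ℝ)
    (θ : EuclideanSpace ℝ (Fin d)) :
    layerScale e t θ + ε • layerScale e u θ = layerScale e (fun j => t j + ε * u j) θ := by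
  apply e.injective
  funext j
  simp only [map_add, map_smul, apply_layerScale, Pi.add_apply, Pi.smul_apply, smul_smul, add_smul]

/-- The scaling factors `(a, b, m, …, m, c)` for the weight matrices of a depth-`n` network. -/
def endScale (n : ℕ) (a b m c : ℝ) (j : ℕ) : ℝ :=
  if j = 0 then a else if j = 1 then b else if j + 1 = n then c else m

lemma prod_endScale {n : ℕ} (hn : 3 ≤ n) (a b c : ℝ) :
    ∏ j ∈ Finset.range n, endScale n a b 1 c j = a * b * c := by
  obtain ⟨k, rfl⟩ := Nat.exists_eq_add_of_le' hn
  rw [Finset.prod_range_succ, Finset.prod_range_succ', Finset.prod_range_succ']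
  have h : ∀ j ∈ Finset.range k, endScale (k + 3) a b 1 c (j + 1 + 1) = 1 := by
    intro j hj
    have := Finset.mem_range.1 hj
    simp [endScale, show j ≠ k by omega]
  rw [Finset.prod_congr rfl h]
  simp [endScale]
  exact Or.inl (mul_comm b a)

lemma layerOut_layerScale {n d : ℕ} {dims : ℕ → ℕ} (hn : 3 ≤ n) (α α' : ℝ)
    (e : EuclideanSpace ℝ (Fin d) ≃ₗ[ℝ] WeightFam n dims)
    (x : EuclideanSpace ℝ (Fin (dims 0))) {a b : ℝ} (ha : 0 ≤ a) (hb : 0 ≤ b) (c : ℝ)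
    (θ : EuclideanSpace ℝ (Fin d)) :
    layerOut α α' dims (e (layerScale e (endScale n a b 1 c) θ)) x n =
      (a * b * c) • layerOut α α' dims (e θ) x n := by
  rw [apply_layerScale, layerOut_smul, prod_endScale hn]
  intro j hj
  unfold endScale
  split_ifs <;> first | assumption | omega | norm_num

/-- Proposition 4 of the paper: for a deep (`n ≥ 3`) fully connected
network with homogeneous non-linear activation and a non-degenerate loss/training set
(there is a weight setting with `∑ᵢ ∇ℓ(0,yᵢ)ᵀ h_θ(xᵢ) ≠ 0`), the infimum over the points
where the training loss is twice continuously differentiable (on a neighborhood) of the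
minimal eigenvalue of its Hessian equals `-∞`. -/
theorem relu_net_hessian_min_eig_unbounded_below {n d : ℕ} (hn : 3 ≤ n)
    (dims : ℕ → ℕ) (hdims : ∀ j, 0 < dims j)
    (α α' : ℝ) (hα : α ≠ α')
    {Y : Type*} (s : ℕ) (hs : 0 < s)
    (x : Fin s → EuclideanSpace ℝ (Fin (dims 0))) (y : Fin s → Y)
    (loss : EuclideanSpace ℝ (Fin (dims n)) → Y → ℝ)
    (hconv : ∀ yy : Y, ConvexOn ℝ Set.univ (fun v => loss v yy))
    (hsm : ∀ yy : Y, ContDiff ℝ 2 (fun v => loss v yy))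
    (arr : EuclideanSpace ℝ (Fin d) →ₗ[ℝ] WeightFam n dims)
    (harr : Function.Bijective arr)
    (hinner : ∀ u v : EuclideanSpace ℝ (Fin d), ⟪u, v⟫ =
      ∑ j : Fin n, ∑ p : Fin (dims (j.val + 1)), ∑ q : Fin (dims j.val),
        arr u j p q * arr v j p q)
    (hnondeg : ∃ θ : EuclideanSpace ℝ (Fin d),
      (∑ i, ⟪gradient (fun v => loss v (y i)) 0,
        layerOut α α' dims (arr θ) (x i) n⟫) ≠ 0) :
    ∀ c : ℝ, ∃ θ : EuclideanSpace ℝ (Fin d),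
      (∃ U : Set (EuclideanSpace ℝ (Fin d)), IsOpen U ∧ θ ∈ U ∧
        ContDiffOn ℝ 2 (netLossNL dims α α' loss x y arr) U) ∧
      ∃ v : EuclideanSpace ℝ (Fin d), ‖v‖ = 1 ∧
        hessQ (netLossNL dims α α' loss x y arr) θ v < c := by
  intro C
  obtain ⟨e, rfl⟩ : ∃ e : EuclideanSpace ℝ (Fin d) ≃ₗ[ℝ] WeightFam n dims, e.toLinearMap = arr :=
    ⟨LinearEquiv.ofBijective arr harr, rfl⟩
  simp only [LinearEquiv.coe_coe] at hnondeg
  set h : Fin s → EuclideanSpace ℝ (Fin d) → EuclideanSpace ℝ (Fin (dims n)) :=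
    fun i θ => layerOut α α' dims (e θ) (x i) n with h_def
  have hA : ∀ j p q, ContDiff ℝ 2 fun θ => e θ j p q := fun j p q =>
    (LinearMap.toContinuousLinearMap
      (LinearMap.proj q ∘ₗ LinearMap.proj p ∘ₗ LinearMap.proj j ∘ₗ e.toLinearMap)).contDiff
  have hreg := fun i => layerOut_regular α α' dims (fun θ => e θ) hA (x i) n
  have hcont : ∀ i, Continuous (h i) := fun i =>
    (PiLp.continuous_toLp 2 _).comp (continuous_pi fun p => (hreg i p).1)
  have hsmooth : ∀ᶠ θ in residual (EuclideanSpace ℝ (Fin d)), ∀ i, ContDiffAt ℝ 2 (h i) θ := by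
    refine Filter.eventually_all.2 fun i => ?_
    filter_upwards [Filter.eventually_all.2 fun p => (hreg i p).2] with θ hθ
    exact contDiffAt_euclidean.2 hθ
  -- A point of smoothness of the network at which the nondegeneracy condition holds.
  obtain ⟨θ, hθ, hg⟩ : ∃ θ, (∀ i, ContDiffAt ℝ 2 (h i) θ) ∧
      ∑ i, ⟪gradient (fun v => loss v (y i)) 0, h i θ⟫ ≠ 0 := by
    have hopen : IsOpen {θ | ∑ i, ⟪gradient (fun v => loss v (y i)) 0, h i θ⟫ ≠ 0} :=
      isOpen_ne_fun (continuous_finsetSum _ fun i _ => continuous_const.inner (hcont i))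
        continuous_const
    obtain ⟨θ, h₁, h₂⟩ := (dense_of_mem_residual hsmooth).inter_open_nonempty _ hopen hnondeg
    exact ⟨θ, h₂, h₁⟩
  set g := ∑ i, ⟪gradient (fun v => loss v (y i)) 0, h i θ⟫ with hg_def
  have hgradc : ∀ yy, Continuous (gradient fun v => loss v yy) := fun yy =>
    continuous_iff_continuousAt.2 fun v =>
      (hsm yy).contDiffAt.differentiableAt_gradient.continuousAt
  set q : ℝ → ℝ := fun τ => ∑ i, ⟪gradient (fun v => loss v (y i)) (τ • h i θ), h i θ⟫ with hq_def
  have hqc : Continuous q := continuous_finsetSum _ fun i _ =>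
    ((hgradc (y i)).comp (continuous_id.smul continuous_const)).inner continuous_const
  have hq0 : q 0 = g := by simp [hq_def, hg_def]
  set f := netLossNL dims α α' loss x y e.toLinearMap with hf_def
  set V := layerScale e (endScale n 1 (-1) 0 0) θ with hV_def
  have hs' : (0 : ℝ) < s := by exact_mod_cast hs
  have hgg : 0 < g ^ 2 := by positivity
  obtain ⟨K, hKq, hK, hK0⟩ : ∃ K : ℝ, g ^ 2 / 2 < g * q (g / K) ∧
      s * (|C| * ‖V‖ ^ 2 + 1) / g ^ 2 < K ∧ 0 < K := by
    have hlim : Filter.Tendsto (fun K : ℝ => g * q (g / K)) Filter.atTop (nhds (g ^ 2)) := by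
      have : Filter.Tendsto (fun K : ℝ => g / K) Filter.atTop (nhds 0) :=
        tendsto_const_nhds.div_atTop Filter.tendsto_id
      simpa [hq0, sq] using ((hqc.tendsto 0).comp this).const_mul g
    exact ((hlim.eventually_const_lt (half_lt_self hgg)).and
      ((Filter.eventually_gt_atTop _).and (Filter.eventually_gt_atTop 0))).exists
  have hK0' : K ≠ 0 := hK0.ne'
  set θ' := layerScale e (endScale n K⁻¹ K⁻¹ 1 (g * K)) θ with hθ'_def
  have hh : ∀ i, ContDiffAt ℝ 2 (h i) θ' := by
    intro i
    have hinv₁ : ∀ j, endScale n K K 1 (g * K)⁻¹ j * endScale n K⁻¹ K⁻¹ 1 (g * K) j = 1 := by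
      intro j
      unfold endScale
      split_ifs <;> field_simp
    have hinv₂ : ∀ j, endScale n K⁻¹ K⁻¹ 1 (g * K) j * endScale n K K 1 (g * K)⁻¹ j = 1 := fun j =>
      (mul_comm _ _).trans (hinv₁ j)
    have heq : h i = fun η => (K⁻¹ * K⁻¹ * (g * K)) •
        h i ((layerScale e (endScale n K K 1 (g * K)⁻¹)).toContinuousLinearMap η) := by
      funext η
      have := layerOut_layerScale hn α α' e (x i) (inv_nonneg.2 hK0.le) (inv_nonneg.2 hK0.le)
        (g * K) (layerScale e (endScale n K K 1 (g * K)⁻¹) η)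
      rwa [layerScale_layerScale_inv e hinv₂] at this
    rw [heq]
    refine ContDiffAt.const_smul _ (ContDiffAt.comp (g := h i) θ' ?_
      (ContinuousLinearMap.contDiff (𝕜 := ℝ) _).contDiffAt)
    rw [LinearMap.coe_toContinuousLinearMap', hθ'_def, layerScale_layerScale_inv e hinv₁]
    exact hθ i
  have hf : ContDiffAt ℝ 2 f θ' :=
    contDiffAt_const.mul (ContDiffAt.sum fun i _ => (hsm (y i)).contDiffAt.comp θ' (hh i))
  have hline : ∀ᶠ ε in nhds (0 : ℝ), f (θ' + ε • V) =
      (1 / (s : ℝ)) * ∑ i, loss (((K⁻¹ + ε) * (K⁻¹ - ε) * (g * K)) • h i θ) (y i) := by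
    have hK' : 0 < K⁻¹ := inv_pos.2 hK0
    filter_upwards [Ioo_mem_nhds (neg_neg_of_pos hK') hK'] with ε hε
    have hcomb : (fun j => endScale n K⁻¹ K⁻¹ 1 (g * K) j + ε * endScale n 1 (-1) 0 0 j) =
        endScale n (K⁻¹ + ε) (K⁻¹ - ε) 1 (g * K) := by
      funext j
      unfold endScale
      split_ifs <;> ring
    have h₁ : 0 ≤ K⁻¹ + ε := by linarith [hε.1]
    have h₂ : 0 ≤ K⁻¹ - ε := by linarith [hε.2]
    rw [hθ'_def, hV_def, layerScale_add_smul, hcomb, hf_def, netLossNL]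
    simp only [LinearEquiv.coe_coe, layerOut_layerScale hn α α' e _ h₁ h₂, h_def]
  have hhess : hessQ f θ' V = -2 * (g * K) * ((1 / (s : ℝ)) * q (g / K)) := by
    refine hessQ_eq_of_line hf
      (ψ' := fun ε => ε * (-2 * (g * K) * ((1 / (s : ℝ)) *
        q ((K⁻¹ + ε) * (K⁻¹ - ε) * (g * K))))) ?_ ?_
    · filter_upwards [hline.eventually_nhds] with ε hε
      refine HasDerivAt.congr_of_eventuallyEq ?_ hε
      have hτ : HasDerivAt (fun ε : ℝ => (K⁻¹ + ε) * (K⁻¹ - ε) * (g * K))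
          (-2 * ε * (g * K)) ε := by
        have := (((hasDerivAt_id ε).const_add K⁻¹).mul
          ((hasDerivAt_id ε).const_sub K⁻¹)).mul_const (g * K)
        refine this.congr_deriv ?_
        simp only [id]
        ring
      have hi : ∀ i ∈ Finset.univ, HasDerivAt
          (fun ε : ℝ => loss (((K⁻¹ + ε) * (K⁻¹ - ε) * (g * K)) • h i θ) (y i))
          (⟪h i θ, gradient (fun v => loss v (y i))
            (((K⁻¹ + ε) * (K⁻¹ - ε) * (g * K)) • h i θ)⟫ * (-2 * ε * (g * K))) ε := by
        intro i _
        have := hasDerivAt_comp_line (f := fun v => loss v (y i)) (θ := 0) (V := h i θ)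
          (ε := (K⁻¹ + ε) * (K⁻¹ - ε) * (g * K)) (((hsm (y i)).differentiable (by norm_num)) _)
        simp only [zero_add] at this
        exact this.comp ε hτ
      refine ((HasDerivAt.fun_sum hi).const_mul (1 / (s : ℝ))).congr_deriv ?_
      simp only [hq_def, ← Finset.sum_mul, real_inner_comm (h _ θ)]
      ring
    · have hc : Continuous fun ε : ℝ => -2 * (g * K) * ((1 / (s : ℝ)) *
          q ((K⁻¹ + ε) * (K⁻¹ - ε) * (g * K))) := by
        fun_prop
      convert hasDerivAt_mul_of_continuousAt hc.continuousAt using 4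
      field_simp
      simp
  have hneg : hessQ f θ' V < -(|C| * ‖V‖ ^ 2) := by
    rw [div_lt_iff₀ hgg] at hK
    have h₁ : hessQ f θ' V = -(2 * (K * (g * q (g / K))) / s) := by
      rw [hhess]
      ring
    have h₂ : |C| * ‖V‖ ^ 2 < 2 * (K * (g * q (g / K))) / s := by
      rw [lt_div_iff₀ hs']
      nlinarith [mul_lt_mul_of_pos_left hKq hK0]
    linarith
  have hV : 0 < ‖V‖ := by
    rw [norm_pos_iff]
    intro hV0
    simp [hV0, hessQ] at hneg
  refine ⟨θ', ?_, ‖V‖⁻¹ • V, ?_, ?_⟩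
  · obtain ⟨U, hU, hUo, hθU⟩ := eventually_nhds_iff.1 (hf.eventually (by simp))
    exact ⟨U, hUo, hθU, fun η hη => (hU η hη).contDiffWithinAt⟩
  · rw [norm_smul, norm_inv, norm_norm, inv_mul_cancel₀ hV.ne']
  · have hle : hessQ f θ' V < C * ‖V‖ ^ 2 := by
      nlinarith [neg_abs_le C, sq_nonneg ‖V‖]
    rw [hessQ_smul, inv_pow, inv_mul_lt_iff₀ (by positivity), mul_comm]
    exact hle
end
end
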